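/- Let (C, μ) be a flat-foldable MV pattern with C = (c_0, …, c_n). Perform any exhaustive sequence of crimp operations on C in which every monocrimp is performed at an adjacent pair of remaining creases of opposite μ-value; let m be the total number of monocrimps performed and let e be the number of creases remaining in the final crease pattern (so m = ((n − 1) − e)/2, and m and e do not depend on the exhaustive sequence chosen). Then (C, μ) has a forcing set of cardinality m + e, and every forcing set of (C, μ) has cardinality at least m + e; i.e., the minimum cardinality of a forcing set of (C, μ) equals m + e = ((n − 1) + e)/2. -/

import Mathlib

/-- Mountain or valley label for a crease. -/
inductive MV : Type
  | M : MV
  | V : MV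
deriving DecidableEq

/-- `(c 0, c 1, …, c n)` is a 1D crease pattern: a strictly increasing finite
sequence of reals with `n ≥ 1`.  The points `c 1, …, c (n-1)` are its creases,
`c 0` and `c n` its ends. -/
def IsCreasePattern (n : ℕ) (c : ℕ → ℝ) : Prop :=
  1 ≤ n ∧ ∀ i j : ℕ, i < j → j ≤ n → c i < c j

/-- The consecutive creases `(c i, …, c (i+k))` form a crimpable sequence with gap `d`. -/
def IsCrimpable (n : ℕ) (c : ℕ → ℝ) (i k : ℕ) (d : ℝ) : Prop :=
  1 ≤ i ∧ 1 ≤ k ∧ i + k ≤ n - 1 ∧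
  (∀ m : ℕ, i ≤ m → m < i + k → c (m + 1) - c m = d) ∧
  d < c i - c (i - 1) ∧ d < c (i + k + 1) - c (i + k)

/-- Additive offset of the folded-position map on the `j`-th interval:
on `[c j, c (j+1)]` the folded-position map is `x ↦ (-1)^j * x + foldOffset c j`. -/
def foldOffset (c : ℕ → ℝ) : ℕ → ℝ
  | 0 => 0
  | j + 1 => foldOffset c (j) + 2 * (-1 : ℝ) ^ j * c (j + 1)

/-- Folded position of a point `x` belonging to the `j`-th interval `[c j, c (j+1)]`.
This is the unique continuous map equal to the identity on `[c 0, c 1]`, isometric on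
every interval, and reversing direction at every crease. -/
def foldPos (c : ℕ → ℝ) (j : ℕ) (x : ℝ) : ℝ := (-1 : ℝ) ^ j * x + foldOffset c j

/-- Folded position of the crease `c i`. -/
def foldCrease (c : ℕ → ℝ) (i : ℕ) : ℝ := foldPos c i (c i)

/-- `x` lies strictly `lt`-between `a` and `b`. -/
def Between (lt : ℕ → ℕ → Prop) (a b x : ℕ) : Prop :=
  (lt a x ∧ lt x b) ∨ (lt b x ∧ lt x a)

/-- The MV pattern `(C, μ)` is flat-foldable: there is a strict linear order `lt`
("strictly below") on the intervals `I_0, …, I_{n-1}` (indexed `0, …, n-1`) such that: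
(i) for each crease `i`, `I_{i-1}` is below `I_i` iff either `μ i = V` and the folded map
is increasing on `I_{i-1}` (slope `(-1)^(i-1) = 1`), or `μ i = M` and it is decreasing;
(ii) for each crease `i` and each interval `J` whose folded image contains the folded
crease position in its interior, `J` is not strictly between `I_{i-1}` and `I_i`;
(iii) for distinct creases `i, j` folding to the same point, it is not the case that
exactly one of `I_{j-1}`, `I_j` is strictly between `I_{i-1}` and `I_i`. -/
def IsFlatFoldable (n : ℕ) (c : ℕ → ℝ) (μ : ℕ → MV) : Prop :=
  ∃ lt : ℕ → ℕ → Prop,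
    (∀ j, j < n → ¬ lt j j) ∧
    (∀ a b e, lt a b → lt b e → lt a e) ∧
    (∀ a b, a < n → b < n → a ≠ b → lt a b ∨ lt b a) ∧
    (∀ a b, lt a b → a < n ∧ b < n) ∧
    (∀ i, 1 ≤ i → i ≤ n - 1 →
      (lt (i - 1) i ↔ ((μ i = MV.V ∧ Even (i - 1)) ∨ (μ i = MV.M ∧ Odd (i - 1))))) ∧
    (∀ i, 1 ≤ i → i ≤ n - 1 → ∀ j, j < n →
      foldCrease c i ∈
        Set.Ioo (min (foldPos c j (c j)) (foldPos c j (c (j + 1))))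
                (max (foldPos c j (c j)) (foldPos c j (c (j + 1)))) →
      ¬ Between lt (i - 1) i j) ∧
    (∀ i j, 1 ≤ i → i ≤ n - 1 → 1 ≤ j → j ≤ n - 1 → i ≠ j →
      foldCrease c i = foldCrease c j →
      (Between lt (i - 1) i (j - 1) ↔ Between lt (i - 1) i j))

/-- `F` is a forcing set for the MV pattern `(C, μ)`: a set of creases such that the only
flat-foldable assignment agreeing with `μ` on `F` is `μ` itself (on all creases). -/
def IsForcingSet (n : ℕ) (c : ℕ → ℝ) (μ : ℕ → MV) (F : Set ℕ) : Prop :=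
  F ⊆ Set.Icc 1 (n - 1) ∧
  ∀ ν : ℕ → MV, IsFlatFoldable n c ν → (∀ x ∈ F, ν x = μ x) →
    ∀ x, 1 ≤ x → x ≤ n - 1 → ν x = μ x

/-- The crease pattern produced by a monocrimp at the adjacent pair `(c j, c (j+1))`:
it deletes `c j` and `c (j+1)` and translates all later points by `-2 * (c (j+1) - c j)`. -/
def monocrimpPattern (c : ℕ → ℝ) (j : ℕ) : ℕ → ℝ :=
  fun x => if x < j then c x else c (x + 2) - 2 * (c (j + 1) - c j)

/-- A state of the folding process: the set of surviving (alive) indices of the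
original crease pattern, together with the current positions of the points.
Creases keep their identity (original index) while their positions shift. -/
structure PState where
  alive : Finset ℕ
  pos : ℕ → ℝ

/-- `a` and `b` are adjacent surviving points (no survivor strictly between them). -/
def Adjacent (s : Finset ℕ) (a b : ℕ) : Prop :=
  a ∈ s ∧ b ∈ s ∧ a < b ∧ ∀ x ∈ s, ¬ (a < x ∧ x < b)

/-- A monocrimp at the adjacent surviving pair `(a, b)`: the two neighboring intervals
are at least as long as the middle one; `a`, `b` are deleted and all later points are
translated by `-2 * (pos b - pos a)`. -/
def Monocrimp (a b : ℕ) (S T : PState) : Prop :=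
  Adjacent S.alive a b ∧
  (∃ l, Adjacent S.alive l a ∧ S.pos b - S.pos a ≤ S.pos a - S.pos l) ∧
  (∃ r, Adjacent S.alive b r ∧ S.pos b - S.pos a ≤ S.pos r - S.pos b) ∧
  T.alive = S.alive \ {a, b} ∧
  T.pos = fun x => if b < x then S.pos x - 2 * (S.pos b - S.pos a) else S.pos x

/-- The set `α` of surviving creases forms a crimpable sequence with gap `d` in state `S`:
`α` is a set of consecutive survivors, equally spaced at distance `d`, and the intervals
adjacent to its two ends are strictly longer than `d`. -/
def CrimpableIn (S : PState) (α : Finset ℕ) (d : ℝ) : Prop :=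
  ∃ lo hi, lo ∈ α ∧ hi ∈ α ∧ (∀ x ∈ α, lo ≤ x ∧ x ≤ hi) ∧ 2 ≤ α.card ∧
    α ⊆ S.alive ∧
    (∀ x ∈ S.alive, lo ≤ x → x ≤ hi → x ∈ α) ∧
    (∀ a b, a ∈ α → b ∈ α → Adjacent S.alive a b → S.pos b - S.pos a = d) ∧
    (∃ l, Adjacent S.alive l lo ∧ d < S.pos lo - S.pos l) ∧
    (∃ r, Adjacent S.alive hi r ∧ d < S.pos r - S.pos hi)

/-- A monocrimp step performed at an adjacent pair of the remaining creases of `α`. -/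
def StepIn (α : Finset ℕ) (S T : PState) : Prop :=
  ∃ a b, a ∈ α ∧ b ∈ α ∧ Monocrimp a b S T

/-- A monocrimp step at an adjacent pair of remaining creases of `α` of opposite μ-value. -/
def StepInMV (μ : ℕ → MV) (α : Finset ℕ) (S T : PState) : Prop :=
  ∃ a b, a ∈ α ∧ b ∈ α ∧ μ a ≠ μ b ∧ Monocrimp a b S T

/-- A crimp operation on the crimpable sequence `α`: a sequence of monocrimps at adjacent
pairs of the remaining creases of `α` until no crease or exactly one crease of `α` remains. -/
def CrimpOp (α : Finset ℕ) (S T : PState) : Prop :=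
  (∃ d, CrimpableIn S α d) ∧
  (∃ (m : ℕ) (W : ℕ → PState), W 0 = S ∧ W m = T ∧ (∀ t, t < m → StepIn α (W t) (W (t + 1)))) ∧
  ((T.alive ∩ α).card ≤ 1)

/-- A crimp operation on `α` in which every monocrimp pair has opposite μ-values. -/
def CrimpOpMV (μ : ℕ → MV) (α : Finset ℕ) (S T : PState) : Prop :=
  (∃ d, CrimpableIn S α d) ∧
  (∃ (m : ℕ) (W : ℕ → PState), W 0 = S ∧ W m = T ∧ (∀ t, t < m → StepInMV μ α (W t) (W (t + 1)))) ∧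
  ((T.alive ∩ α).card ≤ 1)

/-- The initial state of the crease pattern `(c 0, …, c n)`. -/
def initState (n : ℕ) (c : ℕ → ℝ) : PState := ⟨Finset.range (n + 1), c⟩

/-- `S 0, …, S m` is a sequence of crimp operations performed on `(c 0, …, c n)`,
with the `t`-th crimp performed on the crimpable sequence `α t`. -/
def CrimpSeq (n : ℕ) (c : ℕ → ℝ) (m : ℕ) (α : ℕ → Finset ℕ) (S : ℕ → PState) : Prop :=
  S 0 = initState n c ∧ ∀ t, t < m → CrimpOp (α t) (S t) (S (t + 1))

/-- Same, where every monocrimp is performed at a pair of creases of opposite μ-value. -/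
def CrimpSeqMV (μ : ℕ → MV) (n : ℕ) (c : ℕ → ℝ) (m : ℕ)
    (α : ℕ → Finset ℕ) (S : ℕ → PState) : Prop :=
  S 0 = initState n c ∧ ∀ t, t < m → CrimpOpMV μ (α t) (S t) (S (t + 1))

/-- The state contains no crimpable sequence (the sequence of crimps was exhaustive). -/
def Exhausted (S : PState) : Prop := ¬ ∃ α d, CrimpableIn S α d

/-- `z` lies strictly between `x` and `y`. -/
def Inside {R : Type*} [LT R] (x y z : R) : Prop := (x < z ∧ z < y) ∨ (y < z ∧ z < x)

theorem Adjacent.right_unique {s : Finset ℕ} {a b c : ℕ} (h : Adjacent s a b)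
    (h' : Adjacent s a c) : b = c := by
  obtain ⟨_, h2, h3, h4⟩ := h
  obtain ⟨_, h6, h7, h8⟩ := h'
  have := h4 c h6
  have := h8 b h2
  omega

theorem Adjacent.left_unique {s : Finset ℕ} {a b c : ℕ} (h : Adjacent s a c)
    (h' : Adjacent s b c) : a = b := by
  obtain ⟨h1, h2, h3, h4⟩ := h
  obtain ⟨h5, h6, h7, h8⟩ := h'
  have := h4 b h5
  have := h8 a h1
  omega

theorem exists_adjacent_right {s : Finset ℕ} {a z : ℕ} (ha : a ∈ s) (hz : z ∈ s) (h : a < z) :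
    ∃ b, Adjacent s a b ∧ b ≤ z := by
  have hne : (s.filter (a < ·)).Nonempty := ⟨z, by simp [hz, h]⟩
  have hm := Finset.min'_mem _ hne
  refine ⟨(s.filter (a < ·)).min' hne, ⟨ha, ?_, ?_, ?_⟩, ?_⟩
  · exact (Finset.mem_filter.1 hm).1
  · exact (Finset.mem_filter.1 hm).2
  · rintro x hx ⟨h1, h2⟩
    exact absurd (Finset.min'_le _ x (by simp [hx, h1])) (not_le.2 h2)
  · exact Finset.min'_le _ z (by simp [hz, h])

theorem exists_adjacent_left {s : Finset ℕ} {a z : ℕ} (ha : a ∈ s) (hz : z ∈ s) (h : z < a) :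
    ∃ b, Adjacent s b a ∧ z ≤ b := by
  have hne : (s.filter (· < a)).Nonempty := ⟨z, by simp [hz, h]⟩
  have hm := Finset.max'_mem _ hne
  refine ⟨(s.filter (· < a)).max' hne, ⟨?_, ha, ?_, ?_⟩, ?_⟩
  · exact (Finset.mem_filter.1 hm).1
  · exact (Finset.mem_filter.1 hm).2
  · rintro x hx ⟨h1, h2⟩
    exact absurd (Finset.le_max' _ x (by simp [hx, h2])) (not_le.2 h1)
  · exact Finset.le_max' _ z (by simp [hz, h])

/-- Adjacency after deleting two consecutive survivors. -/
theorem adjacent_sdiff_pair {s : Finset ℕ} {l a b r : ℕ} (hla : Adjacent s l a)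
    (hab : Adjacent s a b) (hbr : Adjacent s b r) (x y : ℕ) :
    Adjacent (s \ {a, b}) x y ↔
      (Adjacent s x y ∧ x ≠ l ∧ x ≠ a ∧ x ≠ b ∧ y ≠ a ∧ y ≠ b ∧ y ≠ r) ∨ (x = l ∧ y = r) := by
  constructor
  · intro h
    by_cases hx : x = l
    · right
      subst hx
      refine ⟨rfl, ?_⟩
      unfold Adjacent at *
      simp only [Finset.mem_sdiff, Finset.mem_insert, Finset.mem_singleton, not_or] at h
      grind
    · left
      unfold Adjacent at *
      simp only [Finset.mem_sdiff, Finset.mem_insert, Finset.mem_singleton, not_or] at h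
      grind
  · rintro (⟨h, h1, h2, h3, h4, h5, h6⟩ | ⟨rfl, rfl⟩)
    · unfold Adjacent at *
      simp only [Finset.mem_sdiff, Finset.mem_insert, Finset.mem_singleton, not_or]
      grind
    · unfold Adjacent at *
      simp only [Finset.mem_sdiff, Finset.mem_insert, Finset.mem_singleton, not_or]
      grind

/-- Heights `h` of the intervals (named by their left endpoints) of the survivors `s`, folded to
the positions `p`, describing a stack of layers without crossings. -/
structure Stack (s : Finset ℕ) (p : ℕ → ℝ) (h : ℕ → ℤ) : Prop where
  inj : ∀ a b a' b', Adjacent s a b → Adjacent s a' b' → h a = h a' → a = a'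
  turn : ∀ a b c, Adjacent s a b → Adjacent s b c →
    (p a < p b ∧ p c < p b) ∨ (p b < p a ∧ p b < p c)
  tort : ∀ a b c u v, Adjacent s a b → Adjacent s b c → Adjacent s u v →
    Inside (p u) (p v) (p b) → ¬ Inside (h a) (h b) (h u)
  taco : ∀ a b c a' b' c', Adjacent s a b → Adjacent s b c → Adjacent s a' b' →
    Adjacent s b' c' → p b = p b' → (Inside (h a) (h b) (h a') ↔ Inside (h a) (h b) (h b'))

theorem inside_neg {R : Type*} [AddCommGroup R] [LinearOrder R] [IsOrderedAddMonoid R] (x y z : R) :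
    Inside (-x) (-y) (-z) ↔ Inside x y z := by
  simp only [Inside, neg_lt_neg_iff]; tauto

theorem Stack.neg_pos {s : Finset ℕ} {p : ℕ → ℝ} {h : ℕ → ℤ} (H : Stack s p h) :
    Stack s (fun x => - p x) h where
  inj := H.inj
  turn a b c h1 h2 := by
    rcases H.turn a b c h1 h2 with h | h
    · right; simpa using h
    · left; simpa using h
  tort a b c u v h1 h2 h3 h4 := H.tort a b c u v h1 h2 h3 ((inside_neg _ _ _).1 h4)
  taco a b c a' b' c' h1 h2 h3 h4 h5 := H.taco a b c a' b' c' h1 h2 h3 h4 (by simpa using h5)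

theorem Stack.neg_height {s : Finset ℕ} {p : ℕ → ℝ} {h : ℕ → ℤ} (H : Stack s p h) :
    Stack s p (fun x => - h x) where
  inj a b a' b' h1 h2 h3 := H.inj a b a' b' h1 h2 (by simpa using h3)
  turn := H.turn
  tort a b c u v h1 h2 h3 h4 := by
    simpa only [inside_neg] using H.tort a b c u v h1 h2 h3 h4
  taco a b c a' b' c' h1 h2 h3 h4 h5 := by
    simpa only [inside_neg] using H.taco a b c a' b' c' h1 h2 h3 h4 h5

theorem exists_scaled_blocks (s : Finset ℕ) (h blk : ℕ → ℤ) : ∃ h' : ℕ → ℤ, ∀ x ∈ s, ∀ y ∈ s,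
    (h' x < h' y ↔ blk x < blk y ∨ (blk x = blk y ∧ h x < h y)) ∧
    (h' x = h' y → h x = h y) := by
  obtain ⟨K, hK⟩ : ∃ K : ℤ, ∀ x ∈ s, |h x| < K := by
    refine ⟨∑ x ∈ s, |h x| + 1, fun x hx => ?_⟩
    have := Finset.single_le_sum (f := fun x => |h x|) (fun i _ => abs_nonneg (h i)) hx
    omega
  refine ⟨fun x => 2 * K * blk x + h x, fun x hx y hy => ?_⟩
  have hx' := abs_lt.1 (hK x hx)
  have hy' := abs_lt.1 (hK y hy)
  have hK0 : 0 < 2 * K := by omega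
  simp only
  rcases lt_trichotomy (blk x) (blk y) with hlt | heq | hgt
  · have : 2 * K * (blk x + 1) ≤ 2 * K * blk y := mul_le_mul_of_nonneg_left hlt hK0.le
    rw [mul_add, mul_one] at this
    constructor
    · constructor <;> intros <;> omega
    · intros; omega
  · rw [heq]
    constructor
    · constructor <;> intros <;> omega
    · intros; omega
  · have : 2 * K * (blk y + 1) ≤ 2 * K * blk x := mul_le_mul_of_nonneg_left hgt hK0.le
    rw [mul_add, mul_one] at this
    constructor
    · constructor <;> intros <;> omega
    · intros; omega

/-- The block of the new stack into which a layer goes when `l`, `a`, `b` get merged. -/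
def BlockSpec (p : ℕ → ℝ) (h : ℕ → ℤ) (l a b x x' : ℕ) (k : ℤ) : Prop :=
  (k = 0 ∧ h x < h l) ∨
  (k = 1 ∧ h l < h x ∧ h x < h b ∧ ((h x < h a ∧ p a ≤ p x ∧ p a ≤ p x') ∨
    (h a < h x ∧ p b ≤ p x ∧ p b ≤ p x'))) ∨
  (k = 3 ∧ h l < h x ∧ h x < h b ∧ ((h x < h a ∧ p x ≤ p a ∧ p x' ≤ p a) ∨
    (h a < h x ∧ p x ≤ p b ∧ p x' ≤ p b))) ∨
  (k = 4 ∧ h b < h x)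

theorem Stack.exists_block {s : Finset ℕ} {p : ℕ → ℝ} {h : ℕ → ℤ} (H : Stack s p h)
    {l a b r : ℕ} (hla : Adjacent s l a) (hab : Adjacent s a b) (hbr : Adjacent s b r) :
    ∃ blk : ℕ → ℤ, blk l = 2 ∧ ∀ x x', Adjacent s x x' → x ≠ l → x ≠ a → x ≠ b →
      BlockSpec p h l a b x x' (blk x) := by
  have : ∀ x, ∃ k : ℤ, (x = l → k = 2) ∧ ∀ x', Adjacent s x x' → x ≠ l → x ≠ a → x ≠ b →
      BlockSpec p h l a b x x' k := by
    intro x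
    by_cases hxl : x = l
    · exact ⟨2, fun _ => rfl, fun _ _ h => absurd hxl h⟩
    by_cases hxa : x = a
    · exact ⟨2, fun _ => rfl, fun _ _ _ h => absurd hxa h⟩
    by_cases hxb : x = b
    · exact ⟨2, fun _ => rfl, fun _ _ _ _ h => absurd hxb h⟩
    by_cases hx : ∃ x', Adjacent s x x'
    · obtain ⟨x', hx⟩ := hx
      have e1 : h x ≠ h l := fun e => hxl (H.inj _ _ _ _ hx hla e)
      have e2 : h x ≠ h a := fun e => hxa (H.inj _ _ _ _ hx hab e)
      have e3 : h x ≠ h b := fun e => hxb (H.inj _ _ _ _ hx hbr e)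
      have t1 := H.tort l a b x x' hla hab hx
      have t2 := H.tort a b r x x' hab hbr hx
      suffices ∃ k : ℤ, BlockSpec p h l a b x x' k by
        obtain ⟨k, hk⟩ := this
        refine ⟨k, fun e => absurd e hxl, fun y hy _ _ _ => ?_⟩
        rwa [hy.right_unique hx]
      unfold Inside at t1 t2
      rcases lt_or_gt_of_ne e1 with e1 | e1
      · exact ⟨0, Or.inl ⟨rfl, e1⟩⟩
      rcases lt_or_gt_of_ne e3 with e3 | e3
      swap
      · exact ⟨4, Or.inr (Or.inr (Or.inr ⟨rfl, e3⟩))⟩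
      rcases lt_or_gt_of_ne e2 with e2 | e2
      · by_cases hc : p x ≤ p a ∧ p x' ≤ p a
        · exact ⟨3, Or.inr (Or.inr (Or.inl ⟨rfl, e1, e3, Or.inl ⟨e2, hc⟩⟩))⟩
        · refine ⟨1, Or.inr (Or.inl ⟨rfl, e1, e3, Or.inl ⟨e2, ?_⟩⟩)⟩
          grind
      · by_cases hc : p x ≤ p b ∧ p x' ≤ p b
        · exact ⟨3, Or.inr (Or.inr (Or.inl ⟨rfl, e1, e3, Or.inr ⟨e2, hc⟩⟩))⟩
        · refine ⟨1, Or.inr (Or.inl ⟨rfl, e1, e3, Or.inr ⟨e2, ?_⟩⟩)⟩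
          grind
    · exact ⟨2, fun _ => rfl, fun y hy => absurd ⟨y, hy⟩ hx⟩
  choose blk h1 h2 using this
  exact ⟨blk, h1 l rfl, h2⟩

theorem Stack.crimp_aux {s : Finset ℕ} {p : ℕ → ℝ} {h : ℕ → ℤ} (H : Stack s p h)
    {l a b r : ℕ} (hla : Adjacent s l a) (hab : Adjacent s a b) (hbr : Adjacent s b r)
    (q1 : p l ≤ p b) (q2 : p b < p a) (q3 : p a ≤ p r) (o1 : h l < h a) (o2 : h a < h b) :
    ∃ h', Stack (s \ {a, b}) p h' ∧
      ∀ x y w, Adjacent (s \ {a, b}) x y → Adjacent (s \ {a, b}) y w →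
        (h' x < h' y ↔ (if x = l then h b else h x) < h y) := by
  obtain ⟨blk, bl, bs⟩ := H.exists_block hla hab hbr
  obtain ⟨h', hh⟩ := exists_scaled_blocks s h blk
  have lla := hla.2.2.1
  have lab := hab.2.2.1
  have lbr := hbr.2.2.1
  have adj := adjacent_sdiff_pair hla hab hbr
  -- the layers of the new pattern
  have lay : ∀ x y, Adjacent (s \ {a, b}) x y → x ∈ s ∧
      ((x = l ∧ y = r) ∨ (Adjacent s x y ∧ x ≠ l ∧ x ≠ a ∧ x ≠ b ∧
        BlockSpec p h l a b x y (blk x))) := by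
    intro x y hxy
    rcases (adj x y).1 hxy with ⟨h1, h2, h3, h4, h5, h6, h7⟩ | ⟨rfl, rfl⟩
    · exact ⟨h1.1, Or.inr ⟨h1, h2, h3, h4, bs x y h1 h2 h3 h4⟩⟩
    · exact ⟨hla.1, Or.inl ⟨rfl, rfl⟩⟩
  -- the creases of the new pattern, to the left, in the middle and to the right
  have left : ∀ x y w, Adjacent (s \ {a, b}) x y → Adjacent (s \ {a, b}) y w → p y ≤ p b →
      (∃ w0, Adjacent s x y ∧ Adjacent s y w0 ∧ (w0 = w ∨ y = l)) ∧ (blk x = 1 ↔ blk y = 1) := by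
    intro x y w hxy hyw hp
    have bx := lay _ _ hxy
    have by' := lay _ _ hyw
    rcases (adj x y).1 hxy with ⟨h1, h2, h3, h4, h5, h6, h7⟩ | ⟨rfl, rfl⟩
    swap
    · linarith
    replace bx := bx.2.resolve_left (fun e => h2 e.1)
    rcases (adj y w).1 hyw with ⟨k1, k2, -⟩ | ⟨rfl, rfl⟩
    · refine ⟨⟨w, h1, k1, Or.inl rfl⟩, ?_⟩
      replace by' := by'.2.resolve_left (fun e => k2 e.1)
      have t := H.taco a b r x y w hab hbr h1 k1
      have u := H.turn x y w h1 k1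
      have bx' := bx.2.2.2.2
      have by'' := by'.2.2.2.2
      clear bs hh adj lay
      unfold BlockSpec at bx' by''
      unfold Inside at t
      constructor <;> grind
    · refine ⟨⟨a, h1, hla, Or.inr rfl⟩, ?_⟩
      have t := H.taco a b w x y a hab hbr h1 hla
      have bx' := bx.2.2.2.2
      clear bs hh adj lay
      unfold BlockSpec at bx'
      unfold Inside at t
      grind
  have right : ∀ x y w, Adjacent (s \ {a, b}) x y → Adjacent (s \ {a, b}) y w → p a ≤ p y →
      (∃ x0, Adjacent s x0 y ∧ Adjacent s y w ∧ (x0 = x ∧ x ≠ l ∨ x = l ∧ x0 = b)) ∧ y ≠ l ∧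
        (blk x = 3 ↔ blk y = 3) := by
    intro x y w hxy hyw hp
    have bx := lay _ _ hxy
    have by' := lay _ _ hyw
    rcases (adj y w).1 hyw with ⟨k1, k2, -⟩ | ⟨rfl, rfl⟩
    swap
    · linarith
    replace by' := by'.2.resolve_left (fun e => k2 e.1)
    rcases (adj x y).1 hxy with ⟨h1, h2, h3, h4, h5, h6, h7⟩ | ⟨rfl, rfl⟩
    · refine ⟨⟨x, h1, k1, Or.inl ⟨rfl, h2⟩⟩, k2, ?_⟩
      replace bx := bx.2.resolve_left (fun e => h2 e.1)
      have t := H.taco l a b x y w hla hab h1 k1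
      have u := H.turn x y w h1 k1
      have bx' := bx.2.2.2.2
      have by'' := by'.2.2.2.2
      clear bs hh adj lay left
      unfold BlockSpec at bx' by''
      unfold Inside at t
      constructor <;> grind
    · refine ⟨⟨b, hbr, k1, Or.inr ⟨rfl, rfl⟩⟩, k2, ?_⟩
      have t := H.taco x a b b y w hla hab hbr k1
      have by'' := by'.2.2.2.2
      clear bs hh adj lay left
      unfold BlockSpec at by''
      unfold Inside at t
      grind
  have middle : ∀ x y w, Adjacent (s \ {a, b}) x y → Adjacent (s \ {a, b}) y w → p b < p y →
      p y < p a → Adjacent s x y ∧ Adjacent s y w ∧ x ≠ l ∧ y ≠ l ∧ blk x = blk y := by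
    intro x y w hxy hyw hp hp'
    have bx := lay _ _ hxy
    have by' := lay _ _ hyw
    rcases (adj y w).1 hyw with ⟨k1, k2, -⟩ | ⟨rfl, rfl⟩
    swap
    · linarith
    replace by' := by'.2.resolve_left (fun e => k2 e.1)
    rcases (adj x y).1 hxy with ⟨h1, h2, h3, h4, h5, h6, h7⟩ | ⟨rfl, rfl⟩
    swap
    · linarith
    refine ⟨h1, k1, h2, k2, ?_⟩
    replace bx := bx.2.resolve_left (fun e => h2 e.1)
    have t1 := H.tort x y w l a h1 k1 hla (Or.inl ⟨by linarith, hp'⟩)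
    have t2 := H.tort x y w a b h1 k1 hab (Or.inr ⟨hp, hp'⟩)
    have t3 := H.tort x y w b r h1 k1 hbr (Or.inl ⟨hp, by linarith⟩)
    have bx' := bx.2.2.2.2
    have by'' := by'.2.2.2.2
    clear bs hh adj lay left right
    unfold BlockSpec at bx' by''
    unfold Inside at t1 t2 t3
    grind
  have oldL : ∀ x y x' y', Adjacent (s \ {a, b}) x x' → Adjacent (s \ {a, b}) y y' →
      blk x ≠ 1 → blk y ≠ 1 → (h' x < h' y ↔ h x < h y) := by
    intro x y x' y' hx hy nx ny
    obtain ⟨mx, hx⟩ := lay _ _ hx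
    obtain ⟨my, hy⟩ := lay _ _ hy
    rw [(hh x mx y my).1]
    clear bs hh adj lay left right middle
    unfold BlockSpec at hx hy
    grind
  have oldR : ∀ x y x' y', Adjacent (s \ {a, b}) x x' → Adjacent (s \ {a, b}) y y' →
      blk x ≠ 3 → blk y ≠ 3 →
      (h' x < h' y ↔ (if x = l then h b else h x) < (if y = l then h b else h y)) := by
    intro x y x' y' hx hy nx ny
    obtain ⟨mx, hx⟩ := lay _ _ hx
    obtain ⟨my, hy⟩ := lay _ _ hy
    rw [(hh x mx y my).1]
    clear bs hh adj lay left right middle oldL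
    unfold BlockSpec at hx hy
    grind
  refine ⟨h', ⟨?_, ?_, ?_, ?_⟩, ?_⟩
  · intro x y x' y' h1 h2 h3
    have e := (hh x (lay _ _ h1).1 x' (lay _ _ h2).1).2 h3
    have : ∀ x y, Adjacent (s \ {a, b}) x y → ∃ z, Adjacent s x z := by
      intro x y h
      obtain ⟨-, ⟨rfl, rfl⟩ | h⟩ := lay _ _ h
      · exact ⟨_, hla⟩
      · exact ⟨_, h.1⟩
    obtain ⟨z, hz⟩ := this _ _ h1
    obtain ⟨z', hz'⟩ := this _ _ h2
    exact H.inj _ _ _ _ hz hz' e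
  · intro x y w h1 h2
    rcases le_or_gt (p y) (p b) with c | c
    · obtain ⟨⟨w0, e1, e2, e3⟩, -⟩ := left x y w h1 h2 c
      have t := H.turn x y w0 e1 e2
      rcases e3 with rfl | rfl
      · exact t
      · rw [e2.right_unique hla] at t
        rcases (adj y w).1 h2 with ⟨-, k2, -⟩ | ⟨-, rfl⟩
        · exact absurd rfl k2
        · grind
    rcases le_or_gt (p a) (p y) with c' | c'
    · obtain ⟨⟨x0, e1, e2, e3⟩, -⟩ := right x y w h1 h2 c'
      have t := H.turn x0 y w e1 e2
      rcases e3 with ⟨rfl, -⟩ | ⟨rfl, rfl⟩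
      · exact t
      · grind
    · obtain ⟨e1, e2, -⟩ := middle x y w h1 h2 c c'
      exact H.turn x y w e1 e2
  · intro x y w u v h1 h2 h3 h4 h5
    have mx := (lay _ _ h1).1
    have my := (lay _ _ h2).1
    obtain ⟨mu, hu⟩ := lay _ _ h3
    have lu : blk l = 2 := bl
    have c1 := hh x mx u mu
    have c2 := hh y my u mu
    have c3 := hh u mu x mx
    have c4 := hh u mu y my
    rcases le_or_gt (p y) (p b) with c | c
    · obtain ⟨⟨w0, e1, e2, e3⟩, e4⟩ := left x y w h1 h2 c
      have nu : blk u ≠ 1 := by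
        clear bs hh adj lay left right middle oldL oldR c1 c2 c3 c4
        unfold BlockSpec at hu
        unfold Inside at h4
        grind
      by_cases hx1 : blk x = 1
      · unfold Inside at h5
        clear bs hh adj lay left right middle oldL oldR
        grind
      · have hy1 := mt e4.2 hx1
        have t : ¬ Inside (h x) (h y) (h u) := by
          rcases hu with ⟨rfl, rfl⟩ | hu
          · refine H.tort x y w0 u a e1 e2 hla ?_
            unfold Inside at h4 ⊢
            left
            rcases h4 with h4 | h4
            · exact ⟨h4.1, by linarith⟩
            · linarith
          · exact H.tort x y w0 u v e1 e2 hu.1 h4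
        apply t
        unfold Inside at h5 ⊢
        rwa [oldL _ _ _ _ h1 h3 hx1 nu, oldL _ _ _ _ h3 h2 nu hy1, oldL _ _ _ _ h2 h3 hy1 nu,
          oldL _ _ _ _ h3 h1 nu hx1] at h5
    rcases le_or_gt (p a) (p y) with c' | c'
    · obtain ⟨⟨x0, e1, e2, e3⟩, e5, e4⟩ := right x y w h1 h2 c'
      have nu : blk u ≠ 3 := by
        clear bs hh adj lay left right middle oldL oldR c1 c2 c3 c4
        unfold BlockSpec at hu
        unfold Inside at h4
        grind
      by_cases hx1 : blk x = 3
      · unfold Inside at h5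
        clear bs hh adj lay left right middle oldL oldR
        grind
      · have hy1 := mt e4.2 hx1
        have hx0 : h x0 = if x = l then h b else h x := by grind
        have t : ¬ Inside (h x0) (h y) (if u = l then h b else h u) := by
          rcases hu with ⟨rfl, rfl⟩ | hu
          · rw [if_pos rfl]
            refine H.tort x0 y w b v e1 e2 hbr ?_
            unfold Inside at h4 ⊢
            left
            rcases h4 with h4 | h4
            · exact ⟨by linarith, h4.2⟩
            · linarith
          · rw [if_neg hu.2.1]
            exact H.tort x0 y w u v e1 e2 hu.1 h4
        apply t
        unfold Inside at h5 ⊢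
        rwa [oldR _ _ _ _ h1 h3 hx1 nu, oldR _ _ _ _ h3 h2 nu hy1, oldR _ _ _ _ h2 h3 hy1 nu,
          oldR _ _ _ _ h3 h1 nu hx1, if_neg e5, ← hx0] at h5
    · obtain ⟨e1, e2, e3, e4, e5⟩ := middle x y w h1 h2 c c'
      have hxl := ((lay _ _ h1).2.resolve_left (fun e => e3 e.1)).2.2.2.2
      rcases hu with ⟨rfl, rfl⟩ | hu
      · clear bs hh adj lay left right middle oldL oldR
        unfold BlockSpec at hxl
        unfold Inside at h5
        grind
      · apply H.tort x y w u v e1 e2 hu.1 h4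
        clear bs hh adj lay left right middle oldL oldR
        unfold Inside at h5 ⊢
        grind
  · intro x y w x' y' w' h1 h2 h1' h2' hp
    have mx := (lay _ _ h1).1
    have my := (lay _ _ h2).1
    have mx' := (lay _ _ h1').1
    have my' := (lay _ _ h2').1
    have c1 := (hh x mx x' mx').1
    have c2 := (hh x mx y' my').1
    have c3 := (hh y my x' mx').1
    have c4 := (hh y my y' my').1
    have d1 := (hh x' mx' x mx).1
    have d2 := (hh x' mx' y my).1
    have d3 := (hh y' my' x mx).1
    have d4 := (hh y' my' y my).1
    rcases le_or_gt (p y) (p b) with c | c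
    · obtain ⟨⟨w0, e1, e2, e3⟩, e4⟩ := left x y w h1 h2 c
      obtain ⟨⟨w0', e1', e2', e3'⟩, e4'⟩ := left x' y' w' h1' h2' (hp ▸ c)
      have t := H.taco x y w0 x' y' w0' e1 e2 e1' e2' hp
      have f1 := oldL x x' _ _ h1 h1'
      have f2 := oldL x y' _ _ h1 h2'
      have f3 := oldL y x' _ _ h2 h1'
      have f4 := oldL y y' _ _ h2 h2'
      have g1 := oldL x' x _ _ h1' h1
      have g2 := oldL x' y _ _ h1' h2
      have g3 := oldL y' x _ _ h2' h1
      have g4 := oldL y' y _ _ h2' h2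
      clear bs hh adj lay left right middle oldL oldR
      unfold Inside at t ⊢
      grind
    rcases le_or_gt (p a) (p y) with c' | c'
    · obtain ⟨⟨x0, e1, e2, e3⟩, e5, e4⟩ := right x y w h1 h2 c'
      obtain ⟨⟨x0', e1', e2', e3'⟩, e5', e4'⟩ := right x' y' w' h1' h2' (hp ▸ c')
      have t := H.taco x0 y w x0' y' w' e1 e2 e1' e2' hp
      have hx0 : h x0 = if x = l then h b else h x := by grind
      have hx0' : h x0' = if x' = l then h b else h x' := by grind
      have f1 := oldR x x' _ _ h1 h1'
      have f2 := oldR x y' _ _ h1 h2'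
      have f3 := oldR y x' _ _ h2 h1'
      have f4 := oldR y y' _ _ h2 h2'
      have g1 := oldR x' x _ _ h1' h1
      have g2 := oldR x' y _ _ h1' h2
      have g3 := oldR y' x _ _ h2' h1
      have g4 := oldR y' y _ _ h2' h2
      rw [← hx0] at f1 f2 g1 g3
      rw [← hx0'] at f1 f3 g1 g2
      rw [if_neg e5] at f3 f4 g2 g4
      rw [if_neg e5'] at f2 f4 g3 g4
      clear bs hh adj lay left right middle oldL oldR
      unfold Inside at t ⊢
      grind
    · obtain ⟨e1, e2, e3, e4, e5⟩ := middle x y w h1 h2 c c'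
      obtain ⟨e1', e2', e3', e4', e5'⟩ := middle x' y' w' h1' h2' (hp ▸ c) (hp ▸ c')
      have t := H.taco x y w x' y' w' e1 e2 e1' e2' hp
      clear bs hh adj lay left right middle oldL oldR
      unfold Inside at t ⊢
      grind
  · intro x y w h1 h2
    have mx := (lay _ _ h1).1
    have my := (lay _ _ h2).1
    rcases le_or_gt (p y) (p b) with c | c
    · obtain ⟨⟨w0, e1, e2, e3⟩, e4⟩ := left x y w h1 h2 c
      have hxl : x ≠ l := by
        rintro rfl
        rcases (adj x y).1 h1 with ⟨-, k2, -⟩ | ⟨-, rfl⟩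
        · exact k2 rfl
        · linarith
      rw [if_neg hxl]
      by_cases hx1 : blk x = 1
      · have := (hh x mx y my).1
        have := e4.1 hx1
        clear bs hh adj lay left right middle oldL oldR
        grind
      · exact oldL _ _ _ _ h1 h2 hx1 (mt e4.2 hx1)
    rcases le_or_gt (p a) (p y) with c' | c'
    · obtain ⟨⟨x0, e1, e2, e3⟩, e5, e4⟩ := right x y w h1 h2 c'
      by_cases hx1 : blk x = 3
      · have := (hh x mx y my).1
        have := e4.1 hx1
        clear bs hh adj lay left right middle oldL oldR
        grind
      · rw [oldR _ _ _ _ h1 h2 hx1 (mt e4.2 hx1), if_neg e5]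
    · obtain ⟨e1, e2, e3, e4, e5⟩ := middle x y w h1 h2 c c'
      have := (hh x mx y my).1
      clear bs hh adj lay left right middle oldL oldR
      grind

/-- Replacing layers of a stack by bundles of consecutive layers: the layer `x` of the new stack
belongs to the bundle of `g x`, in which its position is `off x`. -/
theorem Stack.expand {s t : Finset ℕ} {p : ℕ → ℝ} {h : ℕ → ℤ} (H : Stack t p h) (g : ℕ → ℕ)
    (off : ℕ → ℤ)
    (turn : ∀ a b c, Adjacent s a b → Adjacent s b c →
      (p a < p b ∧ p c < p b) ∨ (p b < p a ∧ p b < p c))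
    (hg : ∀ x x', Adjacent s x x' → ∃ y, Adjacent t (g x) y ∧
      ∀ z, Inside (p x) (p x') z → Inside (p (g x)) (p y) z)
    (hinj : ∀ x x' y y', Adjacent s x x' → Adjacent s y y' → g x = g y → off x = off y → x = y)
    (hcr : ∀ x y w, Adjacent s x y → Adjacent s y w →
      (g x = g y ∧ ∀ u v, Adjacent s u v → g u = g x → ¬ Inside (off x) (off y) (off u)) ∨
      (Adjacent t (g x) y ∧ (∃ z, Adjacent t y z) ∧ g y = y))
    (hco : ∀ x y w x' y' w', Adjacent s x y → Adjacent s y w → Adjacent s x' y' →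
      Adjacent s y' w' → p y = p y' → g x ≠ g y → g x' = g y' →
      (g x' = g x → ((off x < off x' ↔ off x < off y') ∧ (off x' < off x ↔ off y' < off x))) ∧
      (g x' = g y → ((off y < off x' ↔ off y < off y') ∧ (off x' < off y ↔ off y' < off y)))) :
    ∃ h', Stack s p h' ∧ ∀ x y w, Adjacent s x y → Adjacent s y w →
      (h' x < h' y ↔ h (g x) < h (g y) ∨ (g x = g y ∧ off x < off y)) := by
  obtain ⟨h', hh⟩ := exists_scaled_blocks s off (fun x => h (g x))
  have hg' : ∀ x x' y y', Adjacent s x x' → Adjacent s y y' → (h (g x) = h (g y) ↔ g x = g y) := by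
    intro x x' y y' hx hy
    obtain ⟨z, hz, -⟩ := hg _ _ hx
    obtain ⟨z', hz', -⟩ := hg _ _ hy
    exact ⟨H.inj _ _ _ _ hz hz', fun e => by rw [e]⟩
  have cmp : ∀ x x' y y', Adjacent s x x' → Adjacent s y y' →
      (h' x < h' y ↔ h (g x) < h (g y) ∨ (g x = g y ∧ off x < off y)) := by
    intro x x' y y' hx hy
    rw [(hh x hx.1 y hy.1).1, hg' _ _ _ _ hx hy]
  refine ⟨h', ⟨?_, turn, ?_, ?_⟩, fun x y w h1 h2 => cmp _ _ _ _ h1 h2⟩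
  · intro x y x' y' h1 h2 h3
    have c1 := cmp _ _ _ _ h1 h2
    have c2 := cmp _ _ _ _ h2 h1
    have e := (hh x h1.1 x' h2.1).2 h3
    have e' := hg' _ _ _ _ h1 h2
    refine hinj _ _ _ _ h1 h2 ?_ e
    apply e'.1
    omega
  · intro x y w u v h1 h2 h3 h4 h5
    have c1 := cmp _ _ _ _ h1 h3
    have c2 := cmp _ _ _ _ h3 h2
    have c3 := cmp _ _ _ _ h2 h3
    have c4 := cmp _ _ _ _ h3 h1
    rcases hcr x y w h1 h2 with ⟨e1, e2⟩ | ⟨e1, ⟨z, e2⟩, e3⟩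
    · have := e2 u v h3
      unfold Inside at this h5
      grind
    · obtain ⟨v', k1, k2⟩ := hg u v h3
      have k3 := k2 _ h4
      have t := H.tort _ _ _ _ _ e1 e2 k1 k3
      have n1 : g u ≠ g x := by
        intro e
        rw [e] at k1 k3
        rw [k1.right_unique e1] at k3
        unfold Inside at k3
        grind
      have n2 : g u ≠ g y := by
        intro e
        rw [e, e3] at k1 k3
        unfold Inside at k3
        grind
      unfold Inside at t h5
      grind
  · intro x y w x' y' w' h1 h2 h1' h2' hp
    have c1 := cmp _ _ _ _ h1 h1'
    have c2 := cmp _ _ _ _ h1' h2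
    have c3 := cmp _ _ _ _ h2 h1'
    have c4 := cmp _ _ _ _ h1' h1
    have d1 := cmp _ _ _ _ h1 h2'
    have d2 := cmp _ _ _ _ h2' h2
    have d3 := cmp _ _ _ _ h2 h2'
    have d4 := cmp _ _ _ _ h2' h1
    rcases hcr x y w h1 h2 with ⟨e1, e2⟩ | ⟨e1, ⟨z, e2⟩, e3⟩
    · have a1 := e2 _ _ h1'
      have a2 := e2 _ _ h2'
      clear hcr hco cmp hh hg hinj
      unfold Inside at a1 a2 ⊢
      grind
    · have nxy : g x ≠ g y := by
        have := e1.2.2.1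
        omega
      rcases hcr x' y' w' h1' h2' with ⟨f1, f2⟩ | ⟨f1, ⟨z', f2⟩, f3⟩
      · have a1 := hco x y w x' y' w' h1 h2 h1' h2' hp nxy f1
        have b1 := hg' _ _ _ _ h1 h1'
        have b2 := hg' _ _ _ _ h2 h1'
        clear hcr hco cmp hh hg hinj
        unfold Inside
        grind
      · by_cases hyy : y = y'
        · subst hyy
          rw [h1.left_unique h1']
          unfold Inside
          grind
        have t := H.taco _ _ _ _ _ _ e1 e2 f1 f2 hp
        have b1 := hg' _ _ _ _ h1 h1'
        have b2 := hg' _ _ _ _ h2 h1'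
        have b3 := hg' _ _ _ _ h1 h2'
        have b4 := hg' _ _ _ _ h2 h2'
        have n1 : g x ≠ g x' := by
          intro e
          rw [e] at e1
          exact hyy (e1.right_unique f1)
        have u1 := H.turn _ _ _ e1 e2
        have u2 := H.turn _ _ _ f1 f2
        have n2 : g x ≠ g y' := by
          intro e
          rw [e, f3] at u1
          grind
        have n3 : g y ≠ g x' := by
          intro e
          rw [← e, e3] at u2
          grind
        clear hcr hco cmp hh hg hinj
        unfold Inside at t ⊢
        grind

/-- The label `t` at the crease `b` puts the layer to the left of `b` below the one to the
right. -/
def Up (t : MV) (b : ℕ) : Prop := (t = MV.V ∧ Odd b) ∨ (t = MV.M ∧ Even b)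

/-- Flat-foldability of the labels `ν` on the survivors `s` with folded positions `p`. -/
def Foldable (s : Finset ℕ) (p : ℕ → ℝ) (ν : ℕ → MV) : Prop :=
  ∃ h, Stack s p h ∧ ∀ a b c, Adjacent s a b → Adjacent s b c → (h a < h b ↔ Up (ν b) b)

/-- The intervals between survivors are folded alternately to the right and to the left. -/
def Alternating (s : Finset ℕ) (p : ℕ → ℝ) : Prop :=
  ∀ a b, Adjacent s a b → (Even a ∧ Odd b ∧ p a < p b) ∨ (Odd a ∧ Even b ∧ p b < p a)

theorem up_iff_of_ne {t t' : MV} {a b : ℕ} (ht : t ≠ t') (hab : Even a ↔ Odd b) :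
    Up t a ↔ Up t' b := by
  unfold Up
  rw [← Nat.not_even_iff_odd] at *
  cases t <;> cases t' <;> simp_all

theorem up_iff_not_of_eq {t : MV} {a b : ℕ} (hab : Even a ↔ Odd b) :
    Up t a ↔ ¬ Up t b := by
  unfold Up
  rw [← Nat.not_even_iff_odd] at *
  cases t <;> simp_all

theorem Alternating.turn {s : Finset ℕ} {p : ℕ → ℝ} (G : Alternating s p) (a b c : ℕ)
    (h1 : Adjacent s a b) (h2 : Adjacent s b c) :
    (p a < p b ∧ p c < p b) ∨ (p b < p a ∧ p b < p c) := by
  have g1 := G _ _ h1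
  have g2 := G _ _ h2
  rw [← Nat.not_even_iff_odd] at *
  grind

/-- The pair `(a, b)` of survivors between `l` and `r` can be crimped. -/
structure CanCrimp (s : Finset ℕ) (p : ℕ → ℝ) (l a b r : ℕ) : Prop where
  la : Adjacent s l a
  ab : Adjacent s a b
  br : Adjacent s b r
  left : |p b - p a| ≤ |p a - p l|
  right : |p b - p a| ≤ |p r - p b|

/-- In a crimpable zigzag the middle interval is folded into both neighbors. -/
theorem CanCrimp.shape {s : Finset ℕ} {p : ℕ → ℝ} {l a b r : ℕ} (c : CanCrimp s p l a b r)
    (G : Alternating s p) :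
    (Even l ∧ Odd a ∧ Even b ∧ Odd r ∧ p l ≤ p b ∧ p b < p a ∧ p a ≤ p r) ∨
    (Odd l ∧ Even a ∧ Odd b ∧ Even r ∧ p b ≤ p l ∧ p a < p b ∧ p r ≤ p a) := by
  have h1 := c.left
  have h2 := c.right
  rcases G _ _ c.la with g1 | g1 <;> rcases G _ _ c.ab with g2 | g2 <;>
    rcases G _ _ c.br with g3 | g3 <;> simp only [← Nat.not_even_iff_odd] at * <;>
    first | (exfalso; tauto) | skip
  · left
    rw [abs_of_neg (by linarith), abs_of_pos (by linarith)] at h1 h2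
    refine ⟨by tauto, by tauto, by tauto, by tauto, by linarith, by linarith, by linarith⟩
  · right
    rw [abs_of_pos (by linarith), abs_of_neg (by linarith)] at h1 h2
    refine ⟨by tauto, by tauto, by tauto, by tauto, by linarith, by linarith, by linarith⟩

theorem CanCrimp.alternating {s : Finset ℕ} {p : ℕ → ℝ} {l a b r : ℕ} (c : CanCrimp s p l a b r)
    (G : Alternating s p) : Alternating (s \ {a, b}) p := by
  intro x y h
  rcases (adjacent_sdiff_pair c.la c.ab c.br x y).1 h with h | ⟨rfl, rfl⟩
  · exact G _ _ h.1
  · rcases c.shape G with h | h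
    · exact Or.inl ⟨h.1, h.2.2.2.1, by linarith⟩
    · exact Or.inr ⟨h.1, h.2.2.2.1, by linarith⟩

theorem CanCrimp.foldable {s : Finset ℕ} {p : ℕ → ℝ} {l a b r : ℕ} (c : CanCrimp s p l a b r)
    (G : Alternating s p) {ν : ℕ → MV} (hν : ν a ≠ ν b) (F : Foldable s p ν) :
    Foldable (s \ {a, b}) p ν := by
  obtain ⟨h, H, D⟩ := F
  have sh := c.shape G
  have d1 := D _ _ _ c.la c.ab
  have d2 := D _ _ _ c.ab c.br
  have hu : Up (ν a) a ↔ Up (ν b) b := up_iff_of_ne hν (by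
    rcases sh with h | h <;> simp only [← Nat.not_even_iff_odd] at * <;> tauto)
  have n1 : h l ≠ h a := fun e => c.la.2.2.1.ne (H.inj _ _ _ _ c.la c.ab e)
  have n2 : h a ≠ h b := fun e => c.ab.2.2.1.ne (H.inj _ _ _ _ c.ab c.br e)
  have fin : ∀ h' : ℕ → ℤ, (∀ x y w, Adjacent (s \ {a, b}) x y → Adjacent (s \ {a, b}) y w →
      (h' x < h' y ↔ (if x = l then h b else h x) < h y)) →
      ∀ x y w, Adjacent (s \ {a, b}) x y → Adjacent (s \ {a, b}) y w →
      (h' x < h' y ↔ Up (ν y) y) := by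
    intro h' hh x y w h1 h2
    rw [hh x y w h1 h2]
    have e2 : ∃ w, Adjacent s y w := by
      rcases (adjacent_sdiff_pair c.la c.ab c.br y w).1 h2 with h | ⟨rfl, rfl⟩
      · exact ⟨_, h.1⟩
      · exact ⟨_, c.la⟩
    obtain ⟨w0, e2⟩ := e2
    rcases (adjacent_sdiff_pair c.la c.ab c.br x y).1 h1 with h | ⟨rfl, rfl⟩
    · rw [if_neg h.2.1]
      exact D _ _ _ h.1 e2
    · rw [if_pos rfl]
      exact D _ _ _ c.br e2
  have neg : ∀ h' : ℕ → ℤ, Stack (s \ {a, b}) p h' → (∀ x y w, Adjacent (s \ {a, b}) x y →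
      Adjacent (s \ {a, b}) y w → (h' x < h' y ↔ (if x = l then - h b else - h x) < - h y)) →
      ∀ x y w, Adjacent (s \ {a, b}) x y → Adjacent (s \ {a, b}) y w →
      (- h' x < - h' y ↔ (if x = l then h b else h x) < h y) := by
    intro h' H' hh x y w h1 h2
    have k1 := hh x y w h1 h2
    have k2 : h' x ≠ h' y := fun e => h1.2.2.1.ne (H'.inj _ _ _ _ h1 h2 e)
    have e2 : ∃ w, Adjacent s y w := by
      rcases (adjacent_sdiff_pair c.la c.ab c.br y w).1 h2 with h | ⟨rfl, rfl⟩
      · exact ⟨_, h.1⟩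
      · exact ⟨_, c.la⟩
    obtain ⟨w0, e2⟩ := e2
    have k3 : (if x = l then h b else h x) ≠ h y := by
      rcases (adjacent_sdiff_pair c.la c.ab c.br x y).1 h1 with h | ⟨rfl, rfl⟩
      · rw [if_neg h.2.1]
        exact fun e => h.1.2.2.1.ne (H.inj _ _ _ _ h.1 e2 e)
      · rw [if_pos rfl]
        exact fun e => c.br.2.2.1.ne (H.inj _ _ _ _ c.br e2 e)
    split_ifs at k1 k3 ⊢ <;> omega
  rcases sh with ⟨-, -, -, -, q1, q2, q3⟩ | ⟨-, -, -, -, q1, q2, q3⟩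
  · rcases lt_or_gt_of_ne n1 with o | o
    · obtain ⟨h', H', hh⟩ := H.crimp_aux c.la c.ab c.br q1 q2 q3 o (d2.2 (hu.1 (d1.1 o)))
      exact ⟨h', H', fin h' hh⟩
    · obtain ⟨h', H', hh⟩ := H.neg_height.crimp_aux c.la c.ab c.br q1 q2 q3 (by omega)
        (by grind)
      exact ⟨_, H'.neg_height, fin _ (neg h' H' hh)⟩
  · rcases lt_or_gt_of_ne n1 with o | o
    · obtain ⟨h', H', hh⟩ := H.neg_pos.crimp_aux c.la c.ab c.br (by linarith) (by linarith)
        (by linarith) o (d2.2 (hu.1 (d1.1 o)))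
      exact ⟨h', by simpa using H'.neg_pos, fin h' hh⟩
    · obtain ⟨h', H', hh⟩ := H.neg_pos.neg_height.crimp_aux c.la c.ab c.br (by linarith)
        (by linarith) (by linarith) (by omega) (by grind)
      have H2 : Stack (s \ {a, b}) p h' := by simpa using H'.neg_pos
      exact ⟨_, H2.neg_height, fin _ (neg h' H2 hh)⟩

set_option maxHeartbeats 1000000 in
theorem CanCrimp.unfold {s : Finset ℕ} {p : ℕ → ℝ} {l a b r : ℕ} (c : CanCrimp s p l a b r)
    (G : Alternating s p) {ν : ℕ → MV} (hν : ν a ≠ ν b) (F : Foldable (s \ {a, b}) p ν) :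
    Foldable s p ν := by
  obtain ⟨h, H, D⟩ := F
  have sh := c.shape G
  have hu : Up (ν a) a ↔ Up (ν b) b := up_iff_of_ne hν (by
    rcases sh with h | h <;> simp only [← Nat.not_even_iff_odd] at * <;> tauto)
  have adj := adjacent_sdiff_pair c.la c.ab c.br
  have lla := c.la.2.2.1
  have lab := c.ab.2.2.1
  have lbr := c.br.2.2.1
  obtain ⟨σ, hσ, hσu⟩ : ∃ σ : ℤ, (σ = 1 ∨ σ = -1) ∧ (0 < σ ↔ Up (ν a) a) := by
    by_cases h : Up (ν a) a
    · exact ⟨1, by simp, by simp [h]⟩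
    · exact ⟨-1, by simp, by simp [h]⟩
  have old : ∀ x y, Adjacent s x y → (x = l ∧ y = a) ∨ (x = a ∧ y = b) ∨ (x = b ∧ y = r) ∨
      (x ≠ l ∧ x ≠ a ∧ x ≠ b ∧ y ≠ a ∧ y ≠ b ∧ y ≠ r ∧ Adjacent (s \ {a, b}) x y) := by
    intro x y h
    by_cases h1 : x = l
    · subst h1; exact Or.inl ⟨rfl, h.right_unique c.la⟩
    by_cases h2 : x = a
    · subst h2; exact Or.inr (Or.inl ⟨rfl, h.right_unique c.ab⟩)
    by_cases h3 : x = b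
    · subst h3; exact Or.inr (Or.inr (Or.inl ⟨rfl, h.right_unique c.br⟩))
    have h4 : y ≠ a := fun e => h1 ((e ▸ h).left_unique c.la)
    have h5 : y ≠ b := fun e => h2 ((e ▸ h).left_unique c.ab)
    have h6 : y ≠ r := fun e => h3 ((e ▸ h).left_unique c.br)
    exact Or.inr (Or.inr (Or.inr ⟨h1, h2, h3, h4, h5, h6, (adj x y).2 (Or.inl
      ⟨h, h1, h2, h3, h4, h5, h6⟩)⟩))
  have lr : Adjacent (s \ {a, b}) l r := (adj l r).2 (Or.inr ⟨rfl, rfl⟩)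
  have ext : ∀ x y w, Adjacent s x y → Adjacent s y w → y ≠ a → y ≠ b →
      Adjacent (s \ {a, b}) (if x = a ∨ x = b then l else x) y ∧
        ∃ z, Adjacent (s \ {a, b}) y z := by
    intro x y w h1 h2 n1 n2
    constructor
    · rcases old x y h1 with ⟨rfl, rfl⟩ | ⟨rfl, rfl⟩ | ⟨rfl, rfl⟩ | h
      · exact absurd rfl n1
      · exact absurd rfl n2
      · simpa using lr
      · rw [if_neg (by tauto)]
        exact h.2.2.2.2.2.2
    · rcases old y w h2 with ⟨rfl, rfl⟩ | ⟨rfl, rfl⟩ | ⟨rfl, rfl⟩ | h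
      · exact ⟨_, lr⟩
      · exact absurd rfl n1
      · exact absurd rfl n2
      · exact ⟨_, h.2.2.2.2.2.2⟩
  have key := H.expand (s := s) (fun x => if x = a ∨ x = b then l else x)
    (fun x => if x = a then σ else if x = b then 2 * σ else 0) G.turn ?_ ?_ ?_ ?_
  · obtain ⟨h', H', hh⟩ := key
    refine ⟨h', H', fun x y w h1 h2 => ?_⟩
    rw [hh x y w h1 h2]
    by_cases n1 : y = a
    · subst n1
      rw [h1.left_unique c.la]
      simp [lla.ne, (lla.trans lab).ne, hσu]
    by_cases n2 : y = b
    · subst n2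
      rw [h1.left_unique c.ab]
      simp only [true_or, or_true, if_true, lt_irrefl, true_and, false_or, lab.ne', if_false,
        ← hu, ← hσu]
      omega
    obtain ⟨e1, z, e2⟩ := ext x y w h1 h2 n1 n2
    have d := D _ _ _ e1 e2
    rw [if_neg (show ¬ (y = a ∨ y = b) by tauto)]
    constructor
    · rintro (h | ⟨h, -⟩)
      · exact d.1 h
      · exact absurd h e1.2.2.1.ne
    · exact fun h => Or.inl (d.2 h)
  · intro x x' hx
    rcases old x x' hx with ⟨rfl, rfl⟩ | ⟨rfl, rfl⟩ | ⟨rfl, rfl⟩ | h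
    · refine ⟨r, by simpa [lla.ne, (lla.trans lab).ne] using lr, fun z hz => ?_⟩
      simp only [lla.ne, (lla.trans lab).ne, or_self, if_false]
      unfold Inside at hz ⊢
      grind
    · refine ⟨r, by simpa using lr, fun z hz => ?_⟩
      simp only [true_or, if_true]
      unfold Inside at hz ⊢
      grind
    · refine ⟨x', by simpa using lr, fun z hz => ?_⟩
      simp only [or_true, if_true]
      unfold Inside at hz ⊢
      grind
    · refine ⟨x', ?_, fun z hz => ?_⟩
      · rw [if_neg (by tauto)]
        exact h.2.2.2.2.2.2
      · rwa [if_neg (by tauto)]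
  · intro x x' y y' hx hy
    have := old x x' hx
    have := old y y' hy
    clear ext adj old
    grind
  · intro x y w h1 h2
    by_cases n1 : y = a
    · left
      subst n1
      rw [h1.left_unique c.la]
      simp only [true_or, if_true]
      unfold Inside
      clear ext adj old
      grind
    by_cases n2 : y = b
    · left
      subst n2
      rw [h1.left_unique c.ab]
      simp only [true_or, or_true, if_true]
      unfold Inside
      clear ext adj old
      grind
    obtain ⟨e1, z, e2⟩ := ext x y w h1 h2 n1 n2
    right
    exact ⟨e1, ⟨z, e2⟩, by simp [n1, n2]⟩
  · intro x y w x' y' w' h1 h2 h1' h2' hp n1 n2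
    have q1 : p l ≠ p a := fun e => by rcases sh with h | h <;> linarith
    have q2 : p r ≠ p b := fun e => by rcases sh with h | h <;> linarith
    have o1 := old _ _ h1
    have o2 := old _ _ h1'
    have hne : ¬ (x' = x ∧ y' = y) := fun e => n1 (by rw [← e.1, ← e.2]; exact n2)
    clear ext adj old sh D H hu hσu
    rcases o1 with ⟨rfl, rfl⟩ | ⟨rfl, rfl⟩ | ⟨rfl, rfl⟩ | o1 <;>
      rcases o2 with ⟨rfl, rfl⟩ | ⟨rfl, rfl⟩ | ⟨rfl, rfl⟩ | o2 <;> grind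

/-- Folding in a short interval at the left end of the paper. -/
theorem Foldable.insert_left {s : Finset ℕ} {p : ℕ → ℝ} {x a b : ℕ} (G : Alternating s p)
    (hmin : ∀ y ∈ s, x ≤ y) (hxa : Adjacent s x a) (hab : Adjacent s a b)
    (hle : |p a - p x| ≤ |p b - p a|) {ν : ℕ → MV} (F : Foldable (s.erase x) p ν) :
    Foldable s p ν := by
  obtain ⟨h, H, D⟩ := F
  obtain ⟨σ, hσ, hσu⟩ : ∃ σ : ℤ, (σ = 1 ∨ σ = -1) ∧ (σ < 0 ↔ Up (ν a) a) := by
    by_cases h : Up (ν a) a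
    · exact ⟨-1, by simp, by simp [h]⟩
    · exact ⟨1, by simp, by simp [h]⟩
  have adj : ∀ u v, Adjacent s u v → u ≠ x → Adjacent (s.erase x) u v := by
    intro u v h hu
    have := hmin u h.1
    have := h.2.2.1
    exact ⟨Finset.mem_erase.2 ⟨hu, h.1⟩, Finset.mem_erase.2 ⟨by omega, h.2.1⟩, h.2.2.1,
      fun z hz => h.2.2.2 z (Finset.mem_of_mem_erase hz)⟩
  have first : ∀ v, Adjacent s x v → v = a := fun v h => h.right_unique hxa
  have last : ∀ u v, Adjacent s u v → v ≠ x := by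
    intro u v h
    have := hmin u h.1
    have := h.2.2.1
    omega
  have lxa := hxa.2.2.1
  have pab : p a ≠ p b := by
    rcases G _ _ hab with h | h <;> linarith
  have key := H.expand (s := s) (fun u => if u = x then a else u)
    (fun u => if u = x then σ else 0) G.turn ?_ ?_ ?_ ?_
  · obtain ⟨h', H', hh⟩ := key
    refine ⟨h', H', fun u v w h1 h2 => ?_⟩
    rw [hh u v w h1 h2]
    have l1 := last _ _ h1
    by_cases hu : u = x
    · subst hu
      rw [first v h1]
      simp [lxa.ne', hσu]
    · simp only [hu, l1, if_false, lt_irrefl, and_false, or_false]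
      exact D _ _ _ (adj _ _ h1 hu) (adj _ _ h2 l1)
  · intro u v h1
    by_cases hu : u = x
    · subst hu
      rw [first v h1, if_pos rfl]
      refine ⟨b, adj _ _ hab lxa.ne', fun z hz => ?_⟩
      have g1 := G _ _ hxa
      have g2 := G _ _ hab
      unfold Inside at *
      simp only [← Nat.not_even_iff_odd] at *
      clear adj first last
      grind
    · exact ⟨v, by simpa [hu] using adj _ _ h1 hu, fun z hz => by simpa [hu] using hz⟩
  · intro u v u' v' h1 h2
    clear adj first last
    grind
  · intro u v w h1 h2
    have l1 := last _ _ h1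
    by_cases hu : u = x
    · left
      subst hu
      rw [first v h1]
      refine ⟨by simp [lxa.ne'], fun u' v' _ _ => ?_⟩
      unfold Inside
      clear adj first last
      grind
    · right
      simp only [hu, l1, if_false]
      exact ⟨adj _ _ h1 hu, ⟨w, adj _ _ h2 l1⟩, trivial⟩
  · intro u v w u' v' w' h1 h2 h1' h2' hp n1 n2
    have l1 := last _ _ h1
    have l1' := last _ _ h1'
    have hu' : u' = x := by
      by_contra hu'
      simp only [hu', l1', if_false] at n2
      exact h1'.2.2.1.ne n2
    subst hu'
    have := first _ h1'
    subst this
    have hu : u ≠ u' := by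
      rintro rfl
      rw [first _ h1] at n1
      simp [lxa.ne'] at n1
    have k1 : v = v' → u = u' := fun e => by subst e; exact h1.left_unique hxa
    have k2 : u = v' → v = b := fun e => by subst e; exact h1.right_unique hab
    constructor
    · intro e
      simp only [hu, if_true, if_false] at e
      exact absurd (hp.symm.trans (by rw [k2 e.symm])) pab
    · intro e
      simp only [l1, if_true, if_false] at e
      exact absurd (k1 e.symm) hu

/-- Folding in a short interval at the right end of the paper. -/
theorem Foldable.insert_right {s : Finset ℕ} {p : ℕ → ℝ} {x a b : ℕ} (G : Alternating s p)
    (hmax : ∀ y ∈ s, y ≤ x) (hax : Adjacent s a x) (hba : Adjacent s b a)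
    (hle : |p x - p a| ≤ |p a - p b|) {ν : ℕ → MV} (F : Foldable (s.erase x) p ν) :
    Foldable s p ν := by
  obtain ⟨h, H, D⟩ := F
  obtain ⟨σ, hσ, hσu⟩ : ∃ σ : ℤ, (σ = 1 ∨ σ = -1) ∧ (0 < σ ↔ Up (ν a) a) := by
    by_cases h : Up (ν a) a
    · exact ⟨1, by simp, by simp [h]⟩
    · exact ⟨-1, by simp, by simp [h]⟩
  have lax := hax.2.2.1
  have lba := hba.2.2.1
  have last : ∀ u v, Adjacent s u v → u ≠ a → v ≠ x := by
    rintro u v h hu rfl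
    exact hu (h.left_unique hax)
  have adj : ∀ u v, Adjacent s u v → u ≠ a → Adjacent (s.erase x) u v := by
    intro u v h hu
    have := hmax v h.2.1
    have := h.2.2.1
    exact ⟨Finset.mem_erase.2 ⟨by omega, h.1⟩, Finset.mem_erase.2 ⟨last u v h hu, h.2.1⟩, h.2.2.1,
      fun z hz => h.2.2.2 z (Finset.mem_of_mem_erase hz)⟩
  have inner : ∀ u v w, Adjacent s u v → Adjacent s v w → u ≠ a := by
    rintro u v w h1 h2 rfl
    have := h1.right_unique hax
    have := hmax w h2.2.1
    have := h2.2.2.1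
    omega
  have pab : p a ≠ p b := by
    rcases G _ _ hba with h | h <;> linarith
  have key := H.expand (s := s) (fun u => if u = a then b else u)
    (fun u => if u = a then σ else 0) G.turn ?_ ?_ ?_ ?_
  · obtain ⟨h', H', hh⟩ := key
    refine ⟨h', H', fun u v w h1 h2 => ?_⟩
    rw [hh u v w h1 h2]
    have l1 := inner _ _ _ h1 h2
    by_cases hv : v = a
    · subst hv
      rw [h1.left_unique hba]
      simp [lba.ne, hσu]
    · simp only [hv, l1, if_false, lt_irrefl, and_false, or_false]
      exact D _ _ _ (adj _ _ h1 l1) (adj _ _ h2 hv)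
  · intro u v h1
    by_cases hu : u = a
    · subst hu
      rw [h1.right_unique hax, if_pos rfl]
      refine ⟨u, adj _ _ hba lba.ne, fun z hz => ?_⟩
      have g1 := G _ _ hax
      have g2 := G _ _ hba
      unfold Inside at *
      simp only [← Nat.not_even_iff_odd] at *
      clear adj last inner
      grind
    · exact ⟨v, by simpa [hu] using adj _ _ h1 hu, fun z hz => by simpa [hu] using hz⟩
  · intro u v u' v' h1 h2
    clear adj last inner
    grind
  · intro u v w h1 h2
    have l1 := inner _ _ _ h1 h2
    by_cases hv : v = a
    · left
      subst hv
      rw [h1.left_unique hba]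
      refine ⟨by simp [lba.ne], fun u' v' _ _ => ?_⟩
      unfold Inside
      clear adj last inner
      grind
    · right
      simp only [hv, l1, if_false]
      exact ⟨adj _ _ h1 l1, ⟨w, adj _ _ h2 hv⟩, trivial⟩
  · intro u v w u' v' w' h1 h2 h1' h2' hp n1 n2
    have l1 := inner _ _ _ h1 h2
    have l1' := inner _ _ _ h1' h2'
    have hv' : v' = a := by
      by_contra hv'
      simp only [hv', l1', if_false] at n2
      exact h1'.2.2.1.ne n2
    subst hv'
    have e2 := h1'.left_unique hba
    subst e2
    have hv : v ≠ v' := by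
      rintro rfl
      rw [h1.left_unique hba] at n1
      simp [lba.ne] at n1
    have k1 : u = u' → v = v' := fun e => by subst e; exact h1.right_unique hba
    constructor
    · intro e
      simp only [l1, l1', if_false] at e
      exact absurd (k1 e.symm) hv
    · intro e
      simp only [hv, l1', if_false] at e
      exact absurd (hp.symm.trans (by rw [e])) pab

/-- Foldability is transported along a relabeling of survivors that keeps folded positions. -/
theorem Foldable.transfer {s s' : Finset ℕ} {p : ℕ → ℝ} {ν ν' : ℕ → MV} (F : Foldable s p ν)
    (σ : ℕ → ℕ) (hσ : ∀ u v, Adjacent s' u v → Adjacent s (σ u) (σ v))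
    (inj : ∀ u v, u ∈ s' → v ∈ s' → σ u = σ v → u = v) (hp : ∀ u ∈ s', p (σ u) = p u)
    (par : ∀ u ∈ s', (Even (σ u) ↔ Even u))
    (hν : ∀ u v w, Adjacent s' u v → Adjacent s' v w → ν (σ v) = ν' v) : Foldable s' p ν' := by
  obtain ⟨h, H, D⟩ := F
  refine ⟨fun u => h (σ u), ⟨?_, ?_, ?_, ?_⟩, ?_⟩
  · intro a b a' b' h1 h2 e
    exact inj _ _ h1.1 h2.1 (H.inj _ _ _ _ (hσ _ _ h1) (hσ _ _ h2) e)
  · intro a b c h1 h2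
    rw [← hp a h1.1, ← hp b h2.1, ← hp c h2.2.1]
    exact H.turn _ _ _ (hσ _ _ h1) (hσ _ _ h2)
  · intro a b c u v h1 h2 h3
    rw [← hp u h3.1, ← hp b h2.1, ← hp v h3.2.1]
    exact H.tort _ _ _ _ _ (hσ _ _ h1) (hσ _ _ h2) (hσ _ _ h3)
  · intro a b c a' b' c' h1 h2 h3 h4
    rw [← hp b h2.1, ← hp b' h4.1]
    exact H.taco _ _ _ _ _ _ (hσ _ _ h1) (hσ _ _ h2) (hσ _ _ h3) (hσ _ _ h4)
  · intro a b c h1 h2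
    rw [D _ _ _ (hσ _ _ h1) (hσ _ _ h2), hν _ _ _ h1 h2]
    have := par b h2.1
    unfold Up
    rw [← Nat.not_even_iff_odd, ← Nat.not_even_iff_odd, this]

/-- Foldability depends only on the labels of the creases. -/
theorem Foldable.congr {s : Finset ℕ} {p : ℕ → ℝ} {ν ν' : ℕ → MV} (F : Foldable s p ν)
    (hν : ∀ u v w, Adjacent s u v → Adjacent s v w → ν v = ν' v) : Foldable s p ν' :=
  F.transfer id (fun _ _ h => h) (fun _ _ _ _ h => h) (fun _ _ => rfl) (fun _ _ => Iff.rfl) hν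

theorem adjacent_erase_of_min {s : Finset ℕ} {x u v : ℕ} (hmin : ∀ y ∈ s, x ≤ y)
    (h : Adjacent (s.erase x) u v) : Adjacent s u v := by
  refine ⟨Finset.mem_of_mem_erase h.1, Finset.mem_of_mem_erase h.2.1, h.2.2.1, fun z hz hh => ?_⟩
  have := hmin u (Finset.mem_of_mem_erase h.1)
  exact h.2.2.2 z (Finset.mem_erase.2 ⟨by omega, hz⟩) hh

theorem adjacent_erase_of_max {s : Finset ℕ} {x u v : ℕ} (hmax : ∀ y ∈ s, y ≤ x)
    (h : Adjacent (s.erase x) u v) : Adjacent s u v := by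
  refine ⟨Finset.mem_of_mem_erase h.1, Finset.mem_of_mem_erase h.2.1, h.2.2.1, fun z hz hh => ?_⟩
  have := hmax v (Finset.mem_of_mem_erase h.2.1)
  exact h.2.2.2 z (Finset.mem_erase.2 ⟨by omega, hz⟩) hh

/-- A state in which both extreme intervals are longer than their neighbors has a crimpable
sequence. -/
theorem exists_crimpable {S : PState} {x₀ x₁ x₂ y₀ y₁ y₂ : ℕ} (hmin : ∀ y ∈ S.alive, x₀ ≤ y)
    (hmax : ∀ y ∈ S.alive, y ≤ y₀) (h01 : Adjacent S.alive x₀ x₁) (h12 : Adjacent S.alive x₁ x₂)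
    (k10 : Adjacent S.alive y₁ y₀) (k21 : Adjacent S.alive y₂ y₁)
    (hl : S.pos x₂ - S.pos x₁ < S.pos x₁ - S.pos x₀)
    (hr : S.pos y₁ - S.pos y₂ < S.pos y₀ - S.pos y₁) : ∃ α d, CrimpableIn S α d := by
  classical
  let P := (S.alive ×ˢ S.alive).filter (fun q => Adjacent S.alive q.1 q.2)
  have memP : ∀ a b, (a, b) ∈ P ↔ Adjacent S.alive a b := by
    intro a b
    simp only [P, Finset.mem_filter, Finset.mem_product]
    exact ⟨fun h => h.2, fun h => ⟨⟨h.1, h.2.1⟩, h⟩⟩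
  obtain ⟨⟨a₀, b₀⟩, m0, hm0⟩ := Finset.exists_min_image P (fun q => S.pos q.2 - S.pos q.1)
    ⟨(x₀, x₁), (memP _ _).2 h01⟩
  obtain ⟨⟨lo, b⟩, m1', hm1⟩ := Finset.exists_min_image
    (P.filter (fun q => S.pos q.2 - S.pos q.1 = S.pos b₀ - S.pos a₀)) (fun q => q.1)
    ⟨(a₀, b₀), by simp [m0]⟩
  obtain ⟨m1, hd⟩ := Finset.mem_filter.1 m1'
  rw [memP] at m1
  set d := S.pos b₀ - S.pos a₀ with hdd
  have dmin : ∀ u v, Adjacent S.alive u v → d ≤ S.pos v - S.pos u :=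
    fun u v h => hm0 (u, v) ((memP _ _).2 h)
  have lomin : ∀ u v, Adjacent S.alive u v → S.pos v - S.pos u = d → lo ≤ u :=
    fun u v h e => hm1 (u, v) (Finset.mem_filter.2 ⟨(memP _ _).2 h, e⟩)
  have lne : lo ≠ x₀ := by
    rintro rfl
    have := m1.right_unique h01
    subst this
    have := dmin _ _ h12
    linarith
  have hlo := hmin lo m1.1
  obtain ⟨l, hl', -⟩ := exists_adjacent_left m1.1 h01.1 (by omega)
  have hll : d < S.pos lo - S.pos l := by
    refine lt_of_le_of_ne (dmin _ _ hl') fun e => ?_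
    have := lomin _ _ hl' e.symm
    have := hl'.2.2.1
    omega
  have hy1 : d < S.pos y₀ - S.pos y₁ := (dmin _ _ k21).trans_lt hr
  have loy : lo < y₁ := by
    have := hmax b m1.2.1
    have := m1.2.2.1
    have := k10.2.2.2 lo m1.1
    rcases lt_trichotomy lo y₁ with h | h | h
    · exact h
    · subst h
      have := m1.right_unique k10
      subst this
      linarith
    · omega
  have hne : (S.alive.filter (fun u => lo < u ∧
      ∃ r, Adjacent S.alive u r ∧ d < S.pos r - S.pos u)).Nonempty :=
    ⟨y₁, Finset.mem_filter.2 ⟨k10.1, loy, y₀, k10, hy1⟩⟩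
  obtain ⟨hi, hhi, himin⟩ := Finset.exists_min_image _ id hne
  obtain ⟨his, hlohi, r, hr, hdr⟩ := Finset.mem_filter.1 hhi
  refine ⟨S.alive.filter (fun u => lo ≤ u ∧ u ≤ hi), d, lo, hi, ?_, ?_, ?_, ?_, ?_, ?_, ?_,
    ⟨l, hl', hll⟩, ⟨r, hr, hdr⟩⟩
  · simp [m1.1, hlohi.le]
  · simp [his, hlohi.le]
  · intro x hx
    exact (Finset.mem_filter.1 hx).2
  · exact Finset.one_lt_card.2 ⟨lo, by simp [m1.1, hlohi.le], hi, by simp [his, hlohi.le],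
      hlohi.ne⟩
  · exact Finset.filter_subset _ _
  · intro x hx h1 h2
    exact Finset.mem_filter.2 ⟨hx, h1, h2⟩
  · intro u v hu hv huv
    obtain ⟨hu, hu1, hu2⟩ := Finset.mem_filter.1 hu
    obtain ⟨hv, hv1, hv2⟩ := Finset.mem_filter.1 hv
    refine le_antisymm ?_ (dmin _ _ huv)
    by_contra hlt
    push Not at hlt
    have hulo : u ≠ lo := by
      rintro rfl
      have := huv.right_unique m1
      subst this
      linarith
    have : hi ≤ u := himin u (Finset.mem_filter.2 ⟨hu, by omega, v, huv, hlt⟩)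
    have := huv.2.2.1
    omega

theorem CrimpableIn.of_adjacent_imp {S T : PState} {α : Finset ℕ} {d : ℝ} {x : ℕ}
    (hT : T.alive = S.alive.erase x) (hpos : T.pos = S.pos)
    (hx : (∀ y ∈ S.alive, x ≤ y) ∨ (∀ y ∈ S.alive, y ≤ x)) (h : CrimpableIn T α d) :
    CrimpableIn S α d := by
  have adj : ∀ u v, Adjacent T.alive u v → Adjacent S.alive u v := by
    intro u v huv
    rw [hT] at huv
    rcases hx with hx | hx
    · exact adjacent_erase_of_min hx huv
    · exact adjacent_erase_of_max hx huv
  obtain ⟨lo, hi, h1, h2, h3, h4, h5, h6, h7, ⟨l, h8, h9⟩, ⟨r, h10, h11⟩⟩ := h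
  rw [hpos] at *
  have h5' : α ⊆ S.alive := fun y hy => Finset.mem_of_mem_erase (hT ▸ h5 hy)
  refine ⟨lo, hi, h1, h2, h3, h4, h5', ?_, ?_, ⟨l, adj _ _ h8, h9⟩, ⟨r, adj _ _ h10, h11⟩⟩
  · intro y hy h h'
    refine h6 y ?_ h h'
    rw [hT]
    refine Finset.mem_erase.2 ⟨?_, hy⟩
    rintro rfl
    have a1 := (adj _ _ h8).1
    have a2 := (adj _ _ h8).2.2.1
    have b1 := (adj _ _ h10).2.1
    have b2 := (adj _ _ h10).2.2.1
    rcases hx with hx | hx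
    · have := hx _ a1
      omega
    · have := hx _ b1
      omega
  · intro a b ha hb hab
    refine h7 a b ha hb ⟨h5 ha, h5 hb, hab.2.2.1, fun z hz => hab.2.2.2 z ?_⟩
    exact Finset.mem_of_mem_erase (hT ▸ hz)

/-- Without crimpable sequences every labeling is flat-foldable. -/
theorem Exhausted.foldable {S : PState} {p : ℕ → ℝ} (hx : Exhausted S)
    (G : Alternating S.alive p)
    (hlen : ∀ a b, Adjacent S.alive a b → S.pos b - S.pos a = |p b - p a|) (ν : ℕ → MV) :
    Foldable S.alive p ν := by
  obtain ⟨k, hk⟩ : ∃ k, S.alive.card = k := ⟨_, rfl⟩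
  induction k using Nat.strong_induction_on generalizing S with
  | _ k ih =>
    by_cases hch : ∃ x a b, Adjacent S.alive x a ∧ Adjacent S.alive a b
    swap
    · refine ⟨fun a => a, ⟨?_, ?_, ?_, ?_⟩, ?_⟩
      · intro a b a' b' _ _ h
        exact_mod_cast h
      · exact fun a b c h1 h2 => absurd ⟨a, b, c, h1, h2⟩ hch
      · exact fun a b c u v h1 h2 => absurd ⟨a, b, c, h1, h2⟩ hch
      · exact fun a b c _ _ _ h1 h2 => absurd ⟨a, b, c, h1, h2⟩ hch
      · exact fun a b c h1 h2 => absurd ⟨a, b, c, h1, h2⟩ hch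
    obtain ⟨x, a, b, hxa, hab⟩ := hch
    have lxa := hxa.2.2.1
    have lab := hab.2.2.1
    have hne : S.alive.Nonempty := ⟨x, hxa.1⟩
    have hmin : ∀ y ∈ S.alive, S.alive.min' hne ≤ y := fun y hy => Finset.min'_le _ y hy
    have hmax : ∀ y ∈ S.alive, y ≤ S.alive.max' hne := fun y hy => Finset.le_max' _ y hy
    have x0s := Finset.min'_mem _ hne
    have y0s := Finset.max'_mem _ hne
    generalize S.alive.min' hne = x₀ at hmin x0s
    generalize S.alive.max' hne = y₀ at hmax y0s
    have := hmin x hxa.1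
    have := hmax b hab.2.1
    obtain ⟨x₁, h01, hx1⟩ := exists_adjacent_right x0s hxa.2.1 (by omega)
    obtain ⟨x₂, h12, -⟩ := exists_adjacent_right h01.2.1 hab.2.1 (by omega)
    obtain ⟨y₁, k10, hy1⟩ := exists_adjacent_left y0s hxa.2.1 (by omega)
    obtain ⟨y₂, k21, -⟩ := exists_adjacent_left k10.1 hxa.1 (by omega)
    have step : ∀ z ∈ S.alive, ((∀ y ∈ S.alive, z ≤ y) ∨ (∀ y ∈ S.alive, y ≤ z)) →
        Foldable (S.alive.erase z) p ν := by
      intro z hz hext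
      have adj : ∀ u v, Adjacent (S.alive.erase z) u v → Adjacent S.alive u v := by
        intro u v huv
        rcases hext with hext | hext
        · exact adjacent_erase_of_min hext huv
        · exact adjacent_erase_of_max hext huv
      refine ih (S.alive.erase z).card ?_ (S := ⟨S.alive.erase z, S.pos⟩) ?_ ?_ ?_ rfl
      · rw [← hk]
        exact Finset.card_erase_lt_of_mem hz
      · rintro ⟨α, d, h⟩
        exact hx ⟨α, d, CrimpableIn.of_adjacent_imp (S := S) (T := ⟨S.alive.erase z, S.pos⟩)
          rfl rfl hext h⟩
      · exact fun u v h => G u v (adj _ _ h)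
      · exact fun u v h => hlen u v (adj _ _ h)
    by_cases hl : S.pos x₁ - S.pos x₀ ≤ S.pos x₂ - S.pos x₁
    · refine Foldable.insert_left G hmin h01 h12 ?_ (step _ x0s (Or.inl hmin))
      rw [← hlen _ _ h01, ← hlen _ _ h12]
      exact hl
    by_cases hr : S.pos y₀ - S.pos y₁ ≤ S.pos y₁ - S.pos y₂
    · refine Foldable.insert_right G hmax k10 k21 ?_ (step _ y0s (Or.inr hmax))
      rw [← hlen _ _ k10, ← hlen _ _ k21]
      exact hr
    exact absurd (exists_crimpable hmin hmax h01 h12 k10 k21 (not_le.1 hl) (not_le.1 hr)) hx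

/-- The survivors strictly between `l` and `r` are folded onto the ends of `[q, q + d]`, and the
intervals at `l` and `r` stick out of `[q, q + d]`. -/
structure Run (s : Finset ℕ) (p : ℕ → ℝ) (l r : ℕ) (q d : ℝ) : Prop where
  left_mem : l ∈ s
  right_mem : r ∈ s
  lt : l < r
  pos : 0 < d
  mid : ∀ x ∈ s, l < x → x < r → (Even x ∧ p x = q) ∨ (Odd x ∧ p x = q + d)
  left_out : (Even l ∧ p l < q) ∨ (Odd l ∧ q + d < p l)
  right_out : (Even r ∧ p r < q) ∨ (Odd r ∧ q + d < p r)

theorem Alternating.parity {s : Finset ℕ} {p : ℕ → ℝ} (G : Alternating s p) {a b : ℕ}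
    (h : Adjacent s a b) : Even a ↔ Odd b := by
  rcases G _ _ h with h | h <;> simp only [← Nat.not_even_iff_odd] at * <;> tauto

/-- A run with at least two creases has consecutive creases with opposite labels. -/
theorem Run.exists_ne {s : Finset ℕ} {p : ℕ → ℝ} {l r : ℕ} {q d : ℝ} (R : Run s p l r q d)
    (G : Alternating s p) {ν : ℕ → MV} (F : Foldable s p ν) {u v : ℕ} (hu : u ∈ s) (hv : v ∈ s)
    (hlu : l < u) (huv : u < v) (hvr : v < r) :
    ∃ a b, l < a ∧ Adjacent s a b ∧ b < r ∧ ν a ≠ ν b := by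
  by_contra! hsame
  obtain ⟨h, H, D⟩ := F
  have flip : ∀ x y w z, Adjacent s x y → Adjacent s y w → Adjacent s w z → l < y → w < r →
      (h x < h y ↔ h w < h y) := by
    intro x y w z h1 h2 h3 ly wr
    have n : h y ≠ h w := fun e => h2.2.2.1.ne (H.inj _ _ _ _ h2 h3 e)
    have d1 := D _ _ _ h1 h2
    have d2 := D _ _ _ h2 h3
    rw [← hsame y w ly h2 wr] at d2
    rw [d1, up_iff_not_of_eq (G.parity h2), ← d2]
    omega
  have spiral : ∀ w x y, Adjacent s x y → Adjacent s y w → l ≤ x → w < r →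
      Inside (h x) (h y) (h w) := by
    intro w
    induction w using Nat.strong_induction_on with
    | _ w ih =>
      intro x y h1 h2 lx wr
      have lxy := h1.2.2.1
      have lyw := h2.2.2.1
      obtain ⟨z, h3, -⟩ := exists_adjacent_right h2.2.1 R.right_mem wr
      have n1 : h x ≠ h y := fun e => lxy.ne (H.inj _ _ _ _ h1 h2 e)
      have n2 : h y ≠ h w := fun e => lyw.ne (H.inj _ _ _ _ h2 h3 e)
      have n3 : h x ≠ h w := fun e => (lxy.trans lyw).ne (H.inj _ _ _ _ h1 h3 e)
      have f := flip _ _ _ _ h1 h2 h3 (by omega) wr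
      have p1 := G.parity h1
      have p2 := G.parity h2
      have my := R.mid y h1.2.1 (by omega) (by omega)
      have mw := R.mid w h2.2.1 (by omega) wr
      have dpos := R.pos
      rcases lx.eq_or_lt with rfl | lx
      · have ho := R.left_out
        have t := H.tort _ _ _ _ _ h2 h3 h1 (by
          unfold Inside
          simp only [← Nat.not_even_iff_odd] at *
          grind)
        unfold Inside at t ⊢
        omega
      · obtain ⟨k, h0, lk⟩ := exists_adjacent_left h1.1 R.left_mem lx
        have i := ih y lyw _ _ h0 h1 lk (by omega)
        have p0 := G.parity h0
        have mx := R.mid x h1.1 lx (by omega)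
        have t := H.taco _ _ _ _ _ _ h0 h1 h2 h3 (by
          simp only [← Nat.not_even_iff_odd] at *
          grind)
        have f0 := flip _ _ _ _ h0 h1 h2 lx (by omega)
        unfold Inside at i t ⊢
        omega
  obtain ⟨w, h3, lw⟩ := exists_adjacent_left R.right_mem hv hvr
  obtain ⟨y, h2, ly⟩ := exists_adjacent_left h3.1 hu (by omega)
  obtain ⟨x, h1, lx⟩ := exists_adjacent_left h2.1 R.left_mem (by omega)
  have lyw := h2.2.2.1
  have lwr := h3.2.2.1
  refine H.tort _ _ _ _ _ h1 h2 h3 ?_ (spiral w x y h1 h2 lx lwr)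
  have p2 := G.parity h2
  have p3 := G.parity h3
  have my := R.mid y h1.2.1 (by omega) (by omega)
  have mw := R.mid w h2.2.1 (by omega) lwr
  have ho := R.right_out
  have dpos := R.pos
  unfold Inside
  simp only [← Nat.not_even_iff_odd] at *
  grind

theorem Run.canCrimp {s : Finset ℕ} {p : ℕ → ℝ} {l r : ℕ} {q d : ℝ} (R : Run s p l r q d)
    (G : Alternating s p) {a b : ℕ} (la : l < a) (hab : Adjacent s a b) (br : b < r) :
    ∃ l' r', CanCrimp s p l' a b r' := by
  obtain ⟨l', h1, hl'⟩ := exists_adjacent_left hab.1 R.left_mem la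
  obtain ⟨r', h2, hr'⟩ := exists_adjacent_right hab.2.1 R.right_mem br
  have lab := hab.2.2.1
  have ll := h1.2.2.1
  have lr := h2.2.2.1
  have p1 := G.parity h1
  have p2 := G.parity hab
  have p3 := G.parity h2
  have ma := R.mid a hab.1 la (by omega)
  have mb := R.mid b hab.2.1 (by omega) br
  have dpos := R.pos
  have ml : (Even l' ∧ p l' ≤ q) ∨ (Odd l' ∧ q + d ≤ p l') := by
    rcases hl'.eq_or_lt with rfl | hl
    · rcases R.left_out with h | h
      · exact Or.inl ⟨h.1, h.2.le⟩
      · exact Or.inr ⟨h.1, h.2.le⟩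
    · rcases R.mid l' h1.1 hl (by omega) with h | h
      · exact Or.inl ⟨h.1, h.2.le⟩
      · exact Or.inr ⟨h.1, h.2.ge⟩
  have mr : (Even r' ∧ p r' ≤ q) ∨ (Odd r' ∧ q + d ≤ p r') := by
    rcases hr'.eq_or_lt with rfl | hr
    · rcases R.right_out with h | h
      · exact Or.inl ⟨h.1, h.2.le⟩
      · exact Or.inr ⟨h.1, h.2.le⟩
    · rcases R.mid r' h2.2.1 (by omega) hr with h | h
      · exact Or.inl ⟨h.1, h.2.le⟩
      · exact Or.inr ⟨h.1, h.2.ge⟩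
  refine ⟨l', r', h1, hab, h2, ?_, ?_⟩
  · simp only [← Nat.not_even_iff_odd] at *
    have hl : |p b - p a| = d := by
      by_cases e : Even a
      · rw [show p b - p a = d by grind, abs_of_pos dpos]
      · rw [show p b - p a = -d by grind, abs_neg, abs_of_pos dpos]
    rw [hl, le_abs]
    grind
  · simp only [← Nat.not_even_iff_odd] at *
    have hl : |p b - p a| = d := by
      by_cases e : Even a
      · rw [show p b - p a = d by grind, abs_of_pos dpos]
      · rw [show p b - p a = -d by grind, abs_neg, abs_of_pos dpos]
    rw [hl, le_abs]
    grind

theorem Run.subset {s t : Finset ℕ} {p : ℕ → ℝ} {l r : ℕ} {q d : ℝ} (R : Run s p l r q d)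
    (hts : t ⊆ s) (hl : l ∈ t) (hr : r ∈ t) : Run t p l r q d :=
  ⟨hl, hr, R.lt, R.pos, fun x hx => R.mid x (hts hx), R.left_out, R.right_out⟩

/-- The labels in a run can be cancelled in pairs until at most one crease is left. -/
theorem Run.exists_reduced {s : Finset ℕ} {p : ℕ → ℝ} {l r : ℕ} {q d : ℝ} (R : Run s p l r q d)
    (G : Alternating s p) {ν : ℕ → MV} (F : Foldable s p ν) :
    ∃ t ⊆ s, Run t p l r q d ∧ Alternating t p ∧ Foldable t p ν ∧
      (∀ x ∈ s, x ∉ t → l < x ∧ x < r) ∧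
      (∀ x ∈ t, ∀ y ∈ t, l < x → x < r → l < y → y < r → x = y) ∧
      ((s \ t).filter (fun x => ν x = MV.M)).card = ((s \ t).filter (fun x => ν x = MV.V)).card := by
  obtain ⟨k, hk⟩ : ∃ k, s.card = k := ⟨_, rfl⟩
  induction k using Nat.strong_induction_on generalizing s with
  | _ k ih =>
    by_cases hone : ∀ x ∈ s, ∀ y ∈ s, l < x → x < r → l < y → y < r → x = y
    · exact ⟨s, subset_rfl, R, G, F, fun x hx hx' => absurd hx hx', hone, by simp⟩
    push Not at hone
    obtain ⟨x, hx, y, hy, lx, xr, ly, yr, hxy⟩ := hone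
    obtain ⟨a, b, la, hab, br, hν⟩ : ∃ a b, l < a ∧ Adjacent s a b ∧ b < r ∧ ν a ≠ ν b := by
      rcases lt_or_gt_of_ne hxy with h | h
      · exact R.exists_ne G F hx hy lx h yr
      · exact R.exists_ne G F hy hx ly h xr
    have lab := hab.2.2.1
    obtain ⟨l', r', c⟩ := R.canCrimp G la hab br
    have hsub : s \ {a, b} ⊆ s := Finset.sdiff_subset
    have R' : Run (s \ {a, b}) p l r q d := R.subset hsub
      (by
        have := R.left_mem
        simp only [Finset.mem_sdiff, Finset.mem_insert, Finset.mem_singleton, this, true_and]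
        omega)
      (by
        have := R.right_mem
        simp only [Finset.mem_sdiff, Finset.mem_insert, Finset.mem_singleton, this, true_and]
        omega)
    have hlt : (s \ {a, b}).card < k := by
      rw [← hk]
      exact Finset.card_lt_card ⟨hsub, fun h => by simpa using h hab.1⟩
    obtain ⟨t, ht, R'', G'', F'', hrem, huniq, hcard⟩ :=
      ih _ hlt R' (c.alternating G) (c.foldable G hν F) rfl
    refine ⟨t, ht.trans hsub, R'', G'', F'', ?_, huniq, ?_⟩
    · intro x hx hxt
      by_cases h : x ∈ s \ {a, b}
      · exact hrem x h hxt
      · have : x = a ∨ x = b := by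
          by_contra hne
          exact h (by simp [hx, not_or.1 hne])
        omega
    · have hat : a ∉ t := fun h => by simpa using ht h
      have hbt : b ∉ t := fun h => by simpa using ht h
      have e : s \ t = insert a (insert b ((s \ {a, b}) \ t)) := by
        ext x
        have := hab.1
        have := hab.2.1
        simp only [Finset.mem_sdiff, Finset.mem_insert, Finset.mem_singleton]
        by_cases h1 : x = a
        · subst h1; simp [*]
        by_cases h2 : x = b
        · subst h2; simp [*]
        simp [h1, h2]
      rw [e]
      simp only [Finset.filter_insert]
      have ha' : ∀ P : ℕ → Prop, [DecidablePred P] → a ∉ ((s \ {a, b}) \ t).filter P := by simp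
      have hb' : ∀ P : ℕ → Prop, [DecidablePred P] → b ∉ ((s \ {a, b}) \ t).filter P := by simp
      rcases hA : ν a with _ | _ <;> rcases hB : ν b with _ | _ <;>
        simp_all [Finset.card_insert_of_notMem]

/-- The labels on `F` determine `μ` on the survivors `s` other than `0` and `n`. -/
def Forcing (n : ℕ) (s : Finset ℕ) (p : ℕ → ℝ) (μ : ℕ → MV) (F : Finset ℕ) : Prop :=
  (∀ x ∈ F, x ∈ s ∧ x ≠ 0 ∧ x ≠ n) ∧ ∀ ν, Foldable s p ν → (∀ x ∈ F, ν x = μ x) →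
    ∀ x ∈ s, x ≠ 0 → x ≠ n → ν x = μ x

theorem CanCrimp.exists_forcing {n : ℕ} {s : Finset ℕ} {p : ℕ → ℝ} {l a b r : ℕ}
    (c : CanCrimp s p l a b r) (G : Alternating s p) (hn : ∀ x ∈ s, x ≤ n) {μ : ℕ → MV}
    (hμ : μ a ≠ μ b) (Fμ : Foldable s p μ) {F : Finset ℕ} (hF : Forcing n s p μ F) :
    ∃ F', Forcing n (s \ {a, b}) p μ F' ∧ F'.card + 1 ≤ F.card := by
  have lla := c.la.2.2.1
  have lab := c.ab.2.2.1
  have lbr := c.br.2.2.1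
  have rn := hn r c.br.2.1
  refine ⟨F \ {a, b}, ⟨?_, ?_⟩, ?_⟩
  · intro x hx
    obtain ⟨hx, hx'⟩ := Finset.mem_sdiff.1 hx
    exact ⟨Finset.mem_sdiff.2 ⟨(hF.1 x hx).1, hx'⟩, (hF.1 x hx).2⟩
  · intro ν hν hag x hx h0 h1
    obtain ⟨hx, hx'⟩ := Finset.mem_sdiff.1 hx
    have hfold : Foldable s p (fun x => if x = a ∨ x = b then μ x else ν x) := by
      refine c.unfold G (by simpa using hμ) (hν.congr fun u v w h _ => ?_)
      have := (Finset.mem_sdiff.1 h.2.1).2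
      simp only [Finset.mem_insert, Finset.mem_singleton] at this
      rw [if_neg this]
    have := hF.2 _ hfold (fun z hz => ?_) x hx h0 h1
    · rwa [if_neg (by simpa using hx')] at this
    · by_cases hz' : z = a ∨ z = b
      · rw [if_pos hz']
      · rw [if_neg hz']
        exact hag z (Finset.mem_sdiff.2 ⟨hz, by simpa using hz'⟩)
  · by_contra hlt
    have hdis : ∀ x ∈ F, x ≠ a ∧ x ≠ b := by
      intro x hx
      by_contra hxx
      refine hlt (Nat.succ_le_of_lt (Finset.card_lt_card ⟨Finset.sdiff_subset, fun h => ?_⟩))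
      have := h hx
      simp only [Finset.mem_sdiff, Finset.mem_insert, Finset.mem_singleton] at this
      tauto
    have hfold : Foldable s p (fun x => if x = a then μ b else if x = b then μ a else μ x) := by
      refine c.unfold G (by simpa [lab.ne'] using hμ.symm)
        ((c.foldable G hμ Fμ).congr fun u v w h _ => ?_)
      have := (Finset.mem_sdiff.1 h.2.1).2
      simp only [Finset.mem_insert, Finset.mem_singleton, not_or] at this
      rw [if_neg this.1, if_neg this.2]
    have := hF.2 _ hfold (fun z hz => by simp [hdis z hz]) a c.ab.1 (by omega) (by omega)
    simp only [if_true] at this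
    exact hμ this.symm

/-- Moving a lone crease between `l` and `r` to a crease with the same folded position. -/
theorem Foldable.move {t t' : Finset ℕ} {p : ℕ → ℝ} {ν : ℕ → MV} {l r x y : ℕ}
    (F : Foldable t' p ν) (hl : l ∈ t) (hr : r ∈ t) (hx : x ∈ t) (lx : l < x) (xr : x < r)
    (ly : l < y) (yr : y < r) (huniq : ∀ z ∈ t, l < z → z < r → z = x)
    (ht' : t' = insert y (t.erase x)) (hp : p y = p x) (par : Even y ↔ Even x) :
    Foldable t p (Function.update ν x (ν y)) := by
  refine F.transfer (fun u => if u = x then y else u) ?_ ?_ ?_ ?_ ?_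
  · rintro u v ⟨hu, hv, huv, hno⟩
    have m : ∀ z ∈ t, (if z = x then y else z) ∈ t' := by
      intro z hz
      rw [ht']
      by_cases h : z = x <;> simp [h, hz]
    have hul := hno l hl
    have hur := hno r hr
    have hux := hno x hx
    have hu2 := huniq u hu
    have hv2 := huniq v hv
    refine ⟨m u hu, m v hv, ?_, fun z hz => ?_⟩
    · split_ifs <;> omega
    · rw [ht'] at hz
      rcases Finset.mem_insert.1 hz with rfl | hz
      · split_ifs <;> omega
      · obtain ⟨hzx, hz⟩ := Finset.mem_erase.1 hz
        have hz1 := hno z hz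
        have hz2 := huniq z hz
        split_ifs <;> omega
  · intro u v hu hv e
    have hu2 := huniq u hu
    have hv2 := huniq v hv
    split_ifs at e <;> omega
  · intro u _
    split_ifs with h
    · rw [h, hp]
    · rfl
  · intro u _
    split_ifs with h
    · rw [h, par]
    · rfl
  · intro u v w _ _
    by_cases h : v = x
    · simp [h]
    · simp [h]

theorem Run.parity {s : Finset ℕ} {p : ℕ → ℝ} {l r : ℕ} {q d : ℝ} (R : Run s p l r q d)
    (G : Alternating s p)
    (huniq : ∀ x ∈ s, ∀ y ∈ s, l < x → x < r → l < y → y < r → x = y) :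
    ((∀ x ∈ s, ¬ (l < x ∧ x < r)) ∧ (Even l ↔ Odd r)) ∨
      ∃ x ∈ s, l < x ∧ x < r ∧ (Even l ↔ Odd x) ∧ ¬ (Even l ↔ Odd r) := by
  by_cases h : ∀ x ∈ s, ¬ (l < x ∧ x < r)
  · exact Or.inl ⟨h, G.parity ⟨R.left_mem, R.right_mem, R.lt, h⟩⟩
  · push Not at h
    obtain ⟨x, hx, lx, xr⟩ := h
    have h1 : Adjacent s l x := ⟨R.left_mem, hx, lx, fun z hz hh => by
      have := huniq z hz x hx hh.1 (by omega) lx xr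
      omega⟩
    have h2 : Adjacent s x r := ⟨hx, R.right_mem, xr, fun z hz hh => by
      have := huniq z hz x hx (by omega) hh.2 lx xr
      omega⟩
    have p1 := G.parity h1
    have p2 := G.parity h2
    simp only [← Nat.not_even_iff_odd] at *
    exact Or.inr ⟨x, hx, lx, xr, p1, by tauto⟩

theorem MV.eq_of_iff {x y z : MV} (h : x = z ↔ y = z) : x = y := by
  cases x <;> cases y <;> cases z <;> simp_all

theorem card_filter_eq_of_balanced {A : Finset ℕ} {ν : ℕ → MV} {k : ℕ} (hA : A.card = 2 * k)
    (h : (A.filter (fun x => ν x = MV.M)).card = (A.filter (fun x => ν x = MV.V)).card)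
    (τ : MV) : (A.filter (fun x => ν x = τ)).card = k := by
  have h1 := Finset.card_filter_add_card_filter_not (s := A) (fun x => ν x = MV.M)
  have h2 : A.filter (fun x => ¬ ν x = MV.M) = A.filter (fun x => ν x = MV.V) := by
    refine Finset.filter_congr fun x _ => ?_
    cases ν x <;> simp
  rw [h2] at h1
  cases τ <;> omega

theorem insert_sdiff_insert_erase {s t : Finset ℕ} {x y : ℕ} (hs : x ∈ s)
    (hy : y ∈ s) (hyt : y ∈ t → y = x) :
    insert x (s \ t) = insert y (s \ insert y (t.erase x)) := by
  ext z
  simp only [Finset.mem_insert, Finset.mem_sdiff, Finset.mem_erase]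
  by_cases h1 : z = x
  · by_cases h2 : z = y
    · simp [← h1, ← h2]
    · simp [h1, hs]
      tauto
  · by_cases h2 : z = y
    · subst h2
      have : z ∉ t := fun h => h1 (hyt h)
      simp [this, hy]
    · simp [h1, h2]

set_option maxHeartbeats 1000000 in
/-- A forcing set of the crimped pattern extends to one of the pattern before crimping a run. -/
theorem Run.exists_forcing {n : ℕ} {s t : Finset ℕ} {p : ℕ → ℝ} {l r : ℕ} {q d : ℝ}
    (R : Run s p l r q d) (G : Alternating s p) (hn : ∀ x ∈ s, x ≤ n) (hts : t ⊆ s)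
    (Gt : Alternating t p) (hrem : ∀ x ∈ s, x ∉ t → l < x ∧ x < r)
    (huniq : ∀ x ∈ t, ∀ y ∈ t, l < x → x < r → l < y → y < r → x = y) {μ : ℕ → MV} {k : ℕ}
    (hcard : (s \ t).card = 2 * k)
    (hbal : ((s \ t).filter (fun x => μ x = MV.M)).card =
      ((s \ t).filter (fun x => μ x = MV.V)).card)
    {F : Finset ℕ} (hF : Forcing n t p μ F) :
    ∃ F', Forcing n s p μ F' ∧ F'.card = F.card + k := by
  have hl : l ∈ t := by
    by_contra h
    exact absurd (hrem l R.left_mem h).1 (lt_irrefl _)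
  have hr : r ∈ t := by
    by_contra h
    exact absurd (hrem r R.right_mem h).2 (lt_irrefl _)
  have rn := hn r R.right_mem
  have hμ := card_filter_eq_of_balanced hcard hbal
  have Rt : Run t p l r q d := R.subset hts hl hr
  have hbound : ∀ P : ℕ → Prop, [DecidablePred P] → ∀ x ∈ F ∪ (s \ t).filter P,
      x ∈ s ∧ x ≠ 0 ∧ x ≠ n := by
    intro P _ x hx
    rcases Finset.mem_union.1 hx with hx | hx
    · exact ⟨hts (hF.1 x hx).1, (hF.1 x hx).2⟩
    · obtain ⟨hx, -⟩ := Finset.mem_filter.1 hx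
      obtain ⟨hx, hxt⟩ := Finset.mem_sdiff.1 hx
      have := hrem x hx hxt
      exact ⟨hx, by omega, by omega⟩
  have hunion : ∀ τ, (F ∪ (s \ t).filter (fun x => μ x = τ)).card = F.card + k := by
    intro τ
    rw [Finset.card_union_of_disjoint, hμ]
    refine Finset.disjoint_left.2 fun x hx hx' => ?_
    exact (Finset.mem_sdiff.1 (Finset.mem_filter.1 hx').1).2 (hF.1 x hx).1
  have split : ∀ (t' : Finset ℕ), t' ⊆ s → (∀ x ∈ s, x ∉ t' → l < x ∧ x < r) →
      ∀ x, ¬ (l < x ∧ x < r) → (x ∈ t' ↔ x ∈ s) :=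
    fun t' h1 h2 x h3 => ⟨fun h => h1 h, fun h => by
      by_contra h'
      exact h3 (h2 x h h')⟩
  rcases Rt.parity Gt huniq with ⟨hno, par⟩ | ⟨x, hx, lx, xr, parx, par⟩
  · refine ⟨F ∪ (s \ t).filter (fun x => μ x = MV.M), ⟨hbound _, fun ν hν hag => ?_⟩, hunion _⟩
    obtain ⟨t', ht's, R', G', F', hrem', huniq', hbal'⟩ := R.exists_reduced G hν
    rcases R'.parity G' huniq' with ⟨hno', -⟩ | ⟨y, -, -, -, -, par'⟩
    swap
    · exact absurd par par'
    have e : t' = t := by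
      ext z
      by_cases hz : l < z ∧ z < r
      · exact ⟨fun h => absurd hz (hno' z h), fun h => absurd hz (hno z h)⟩
      · rw [split t' ht's hrem' z hz, split t hts hrem z hz]
    subst e
    have hν' := card_filter_eq_of_balanced hcard hbal'
    have heq : (s \ t').filter (fun x => μ x = MV.M) = (s \ t').filter (fun x => ν x = MV.M) := by
      refine Finset.eq_of_subset_of_card_le (fun z hz => ?_) (by rw [hν', hμ])
      have := hag z (Finset.mem_union_right _ hz)
      obtain ⟨hz1, hz2⟩ := Finset.mem_filter.1 hz
      exact Finset.mem_filter.2 ⟨hz1, this.trans hz2⟩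
    intro z hz h0 h1
    by_cases hzt : z ∈ t'
    · exact hF.2 ν F' (fun z hz => hag z (Finset.mem_union_left _ hz)) z hzt h0 h1
    · have := Finset.ext_iff.1 heq z
      simp only [Finset.mem_filter, Finset.mem_sdiff, hz, hzt, not_false_eq_true, true_and] at this
      exact MV.eq_of_iff this.symm
  · -- the run keeps one crease, which may differ for different labelings
    have hxA : x ∉ s \ t := fun h => (Finset.mem_sdiff.1 h).2 hx
    have main : ∀ ν, Foldable s p ν → ∃ y, Foldable t p (Function.update ν x (ν y)) ∧
        ∀ τ, ((insert x (s \ t)).filter (fun z => ν z = τ)).card =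
          k + if ν y = τ then 1 else 0 := by
      intro ν hν
      obtain ⟨t', ht's, R', G', F', hrem', huniq', hbal'⟩ := R.exists_reduced G hν
      rcases R'.parity G' huniq' with ⟨-, par'⟩ | ⟨y, hy, ly, yr, pary, -⟩
      · exact absurd par' par
      have e : t' = insert y (t.erase x) := by
        ext z
        by_cases hz : l < z ∧ z < r
        · simp only [Finset.mem_insert, Finset.mem_erase]
          constructor
          · exact fun h => Or.inl (huniq' z h y hy hz.1 hz.2 ly yr)
          · rintro (rfl | ⟨h1, h2⟩)
            · exact hy
            · exact absurd (huniq z h2 x hx hz.1 hz.2 lx xr) h1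
        · rw [split t' ht's hrem' z hz, Finset.mem_insert, Finset.mem_erase,
            split t hts hrem z hz]
          constructor
          · exact fun h => Or.inr ⟨by rintro rfl; exact hz ⟨lx, xr⟩, h⟩
          · rintro (rfl | ⟨-, h⟩)
            · exact absurd ⟨ly, yr⟩ hz
            · exact h
      have e' : insert x (s \ t) = insert y (s \ t') := by
        rw [e]
        exact insert_sdiff_insert_erase (hts hx) (ht's hy)
          fun h => huniq y h x hx ly yr lx xr
      have hyA : y ∉ s \ t' := fun h => (Finset.mem_sdiff.1 h).2 hy
      have hc' : (s \ t').card = 2 * k := by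
        have h1 := congrArg Finset.card e'
        rw [Finset.card_insert_of_notMem hxA, Finset.card_insert_of_notMem hyA] at h1
        omega
      have hν' := card_filter_eq_of_balanced hc' hbal'
      refine ⟨y, F'.move hl hr hx lx xr ly yr (fun z hz h1 h2 => huniq z hz x hx h1 h2 lx xr) e
        ?_ ?_, fun τ => ?_⟩
      · have mx := R.mid x (hts hx) lx xr
        have my := R.mid y (ht's hy) ly yr
        simp only [← Nat.not_even_iff_odd] at *
        by_cases hxe : Even x
        · have : Even y := by tauto
          rw [show p x = q by tauto, show p y = q by tauto]
        · have : ¬ Even y := by tauto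
          rw [show p x = q + d by tauto, show p y = q + d by tauto]
      · simp only [← Nat.not_even_iff_odd] at *
        tauto
      · rw [e', Finset.filter_insert]
        split_ifs with h
        · rw [Finset.card_insert_of_notMem (fun h => hyA (Finset.mem_filter.1 h).1), hν']
        · rw [hν', add_zero]
    have hμx : ∀ τ, ((insert x (s \ t)).filter (fun z => μ z = τ)).card =
        k + if μ x = τ then 1 else 0 := by
      intro τ
      rw [Finset.filter_insert]
      split_ifs with h
      · rw [Finset.card_insert_of_notMem (fun h => hxA (Finset.mem_filter.1 h).1), hμ]
      · rw [hμ, add_zero]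
    have concl : ∀ (ν : ℕ → MV) (τ : MV),
        (∀ z ∈ insert x (s \ t), μ z = τ → ν z = τ) →
        ((insert x (s \ t)).filter (fun z => ν z = τ)).card ≤
          ((insert x (s \ t)).filter (fun z => μ z = τ)).card →
        ∀ z ∈ insert x (s \ t), ν z = μ z := by
      intro ν τ h1 h2 z hz
      have heq := Finset.eq_of_subset_of_card_le (fun z hz => ?_) h2
      · have := Finset.ext_iff.1 heq z
        simp only [Finset.mem_filter, hz, true_and] at this
        exact MV.eq_of_iff this.symm
      · obtain ⟨hz1, hz2⟩ := Finset.mem_filter.1 hz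
        exact Finset.mem_filter.2 ⟨hz1, h1 z hz1 hz2⟩
    by_cases hxF : x ∈ F
    · refine ⟨F ∪ (s \ t).filter (fun z => μ z = μ x), ⟨hbound _, fun ν hν hag => ?_⟩, hunion _⟩
      obtain ⟨y, F', hc⟩ := main ν hν
      have hsub : ∀ z ∈ insert x (s \ t), μ z = μ x → ν z = μ x := by
        intro z hz hzx
        rcases Finset.mem_insert.1 hz with rfl | hz
        · exact hag z (Finset.mem_union_left _ hxF)
        · exact (hag z (Finset.mem_union_right _ (Finset.mem_filter.2 ⟨hz, hzx⟩))).trans hzx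
      have hle := Finset.card_le_card (s := (insert x (s \ t)).filter (fun z => μ z = μ x))
        (t := (insert x (s \ t)).filter (fun z => ν z = μ x)) (fun z hz => by
          obtain ⟨hz1, hz2⟩ := Finset.mem_filter.1 hz
          exact Finset.mem_filter.2 ⟨hz1, hsub z hz1 hz2⟩)
      have hy : ν y = μ x := by
        by_contra hne
        rw [hc, hμx, if_neg hne, if_pos rfl] at hle
        omega
      have hα := concl ν (μ x) hsub (by rw [hc, hμx, if_pos hy, if_pos rfl])
      intro z hz h0 h1
      by_cases hzt : z ∈ insert x (s \ t)
      · exact hα z hzt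
      · have hzx : z ≠ x := fun h => hzt (h ▸ Finset.mem_insert_self _ _)
        have hz' : z ∈ t := by
          by_contra h
          exact hzt (Finset.mem_insert_of_mem (Finset.mem_sdiff.2 ⟨hz, h⟩))
        have := hF.2 _ F' (fun z hz => ?_) z hz' h0 h1
        · rwa [Function.update_of_ne hzx] at this
        · by_cases h : z = x
          · rw [h, Function.update_self, hy]
          · rw [Function.update_of_ne h]
            exact hag z (Finset.mem_union_left _ hz)
    · obtain ⟨τ, hτ⟩ : ∃ τ, τ ≠ μ x := by
        cases μ x
        · exact ⟨MV.V, by simp⟩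
        · exact ⟨MV.M, by simp⟩
      refine ⟨F ∪ (s \ t).filter (fun z => μ z = τ), ⟨hbound _, fun ν hν hag => ?_⟩, hunion _⟩
      obtain ⟨y, F', hc⟩ := main ν hν
      have ht := hF.2 _ F' (fun z hz => by
        have hzx : z ≠ x := fun h => hxF (h ▸ hz)
        rw [Function.update_of_ne hzx]
        exact hag z (Finset.mem_union_left _ hz))
      have hy : ν y = μ x := by
        have := ht x hx (by omega) (by omega)
        rwa [Function.update_self] at this
      have hα := concl ν τ (fun z hz hzτ => by
        rcases Finset.mem_insert.1 hz with rfl | hz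
        · exact absurd hzτ.symm hτ
        · exact (hag z (Finset.mem_union_right _ (Finset.mem_filter.2 ⟨hz, hzτ⟩))).trans hzτ)
        (by rw [hc, hμx, hy])
      intro z hz h0 h1
      by_cases hzt : z ∈ insert x (s \ t)
      · exact hα z hzt
      · have hzx : z ≠ x := fun h => hzt (h ▸ Finset.mem_insert_self _ _)
        have hz' : z ∈ t := by
          by_contra h
          exact hzt (Finset.mem_insert_of_mem (Finset.mem_sdiff.2 ⟨hz, h⟩))
        have := ht z hz' h0 h1
        rwa [Function.update_of_ne hzx] at this

/-- A crimpable sequence is a run for the folded positions. -/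
theorem CrimpableIn.run {S : PState} {α : Finset ℕ} {d : ℝ} (h : CrimpableIn S α d) {p : ℕ → ℝ}
    (G : Alternating S.alive p)
    (hlen : ∀ a b, Adjacent S.alive a b → S.pos b - S.pos a = |p b - p a|) :
    ∃ l r q, Run S.alive p l r q d ∧ ∀ x, x ∈ α ↔ x ∈ S.alive ∧ l < x ∧ x < r := by
  obtain ⟨lo, hi, hlo, hhi, hbd, hcard, hsub, hconv, hgap, ⟨l, hl, hld⟩, ⟨r, hr, hrd⟩⟩ := h
  have step : ∀ a b, Adjacent S.alive a b →
      (Even a ∧ Odd b ∧ p b = p a + (S.pos b - S.pos a) ∧ 0 < S.pos b - S.pos a) ∨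
        (Odd a ∧ Even b ∧ p a = p b + (S.pos b - S.pos a) ∧ 0 < S.pos b - S.pos a) := by
    intro a b hab
    rcases G a b hab with ⟨h1, h2, h3⟩ | ⟨h1, h2, h3⟩
    · left
      rw [hlen a b hab, abs_of_pos (by linarith)]
      exact ⟨h1, h2, by ring, by linarith⟩
    · right
      rw [hlen a b hab, abs_of_neg (by linarith)]
      exact ⟨h1, h2, by ring, by linarith⟩
  have hlt : lo < hi := by
    by_contra hc
    have : α ⊆ {lo} := fun x hx => by
      have := hbd x hx
      exact Finset.mem_singleton.2 (by omega)
    have := Finset.card_le_card this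
    simp at this
    omega
  obtain ⟨b, hb, hbh⟩ := exists_adjacent_right (hsub hlo) (hsub hhi) hlt
  have hd : 0 < d := by
    rw [← hgap lo b hlo (hconv b hb.2.1 hb.2.2.1.le hbh) hb]
    rcases step lo b hb with h | h
    · exact h.2.2.2
    · exact h.2.2.2
  have hmem : ∀ x, x ∈ α ↔ x ∈ S.alive ∧ l < x ∧ x < r := by
    intro x
    have h1 := hl.2.2.1
    have h2 := hr.2.2.1
    constructor
    · intro hx
      have := hbd x hx
      exact ⟨hsub hx, by omega, by omega⟩
    · rintro ⟨hx, h3, h4⟩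
      have h5 := hl.2.2.2 x hx
      have h6 := hr.2.2.2 x hx
      exact hconv x hx (by omega) (by omega)
  obtain ⟨q, hq⟩ : ∃ q, (Even lo ∧ p lo = q) ∨ (Odd lo ∧ p lo = q + d) := by
    rcases Nat.even_or_odd lo with h | h
    · exact ⟨p lo, Or.inl ⟨h, rfl⟩⟩
    · exact ⟨p lo - d, Or.inr ⟨h, by ring⟩⟩
  have mid : ∀ x ∈ α, (Even x ∧ p x = q) ∨ (Odd x ∧ p x = q + d) := by
    intro x
    induction x using Nat.strong_induction_on with
    | _ x ih =>
      intro hx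
      by_cases hxl : x = lo
      · exact hxl ▸ hq
      · have hb := hbd x hx
        obtain ⟨y, hy, hly⟩ := exists_adjacent_left (hsub hx) (hsub hlo) (by omega)
        have hyx := hy.2.2.1
        have hyα := hconv y hy.1 hly (by omega)
        have hg := hgap y x hyα hx hy
        have h1 := ih y hyx hyα
        have h2 := step y x hy
        rw [hg] at h2
        rcases h2 with ⟨h2, h3, h4, -⟩ | ⟨h2, h3, h4, -⟩
        · rcases h1 with ⟨h5, h6⟩ | ⟨h5, h6⟩
          · exact Or.inr ⟨h3, by rw [h4, h6]⟩
          · exact absurd h2 (Nat.not_even_iff_odd.2 h5)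
        · rcases h1 with ⟨h5, h6⟩ | ⟨h5, h6⟩
          · exact absurd h5 (Nat.not_even_iff_odd.2 h2)
          · exact Or.inl ⟨h3, by linarith⟩
  refine ⟨l, r, q, ⟨hl.1, hr.2.1, ?_, hd, fun x hx h1 h2 => mid x ((hmem x).2 ⟨hx, h1, h2⟩),
    ?_, ?_⟩, hmem⟩
  · have := hl.2.2.1
    have := hr.2.2.1
    omega
  · have h1 := mid lo hlo
    rcases step l lo hl with ⟨h2, h3, h4, -⟩ | ⟨h2, h3, h4, -⟩
    · rcases h1 with ⟨h5, h6⟩ | ⟨h5, h6⟩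
      · exact absurd h5 (Nat.not_even_iff_odd.2 h3)
      · exact Or.inl ⟨h2, by linarith⟩
    · rcases h1 with ⟨h5, h6⟩ | ⟨h5, h6⟩
      · exact Or.inr ⟨h2, by linarith⟩
      · exact absurd h3 (Nat.not_even_iff_odd.2 h5)
  · have h1 := mid hi hhi
    rcases step hi r hr with ⟨h2, h3, h4, -⟩ | ⟨h2, h3, h4, -⟩
    · rcases h1 with ⟨h5, h6⟩ | ⟨h5, h6⟩
      · exact Or.inr ⟨h3, by linarith⟩
      · exact absurd h2 (Nat.not_even_iff_odd.2 h5)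
    · rcases h1 with ⟨h5, h6⟩ | ⟨h5, h6⟩
      · exact absurd h5 (Nat.not_even_iff_odd.2 h2)
      · exact Or.inl ⟨h3, by linarith⟩

/-- The data preserved by monocrimps: the folded positions `p` describe the current pattern. -/
structure Realizes (n : ℕ) (p : ℕ → ℝ) (S : PState) : Prop where
  zero_mem : 0 ∈ S.alive
  last_mem : n ∈ S.alive
  le_last : ∀ x ∈ S.alive, x ≤ n
  alternating : Alternating S.alive p
  length_eq : ∀ a b, Adjacent S.alive a b → S.pos b - S.pos a = |p b - p a|

theorem Monocrimp.canCrimp {n : ℕ} {p : ℕ → ℝ} {a b : ℕ} {S T : PState}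
    (h : Monocrimp a b S T) (I : Realizes n p S) : ∃ l r, CanCrimp S.alive p l a b r := by
  obtain ⟨hab, ⟨l, hl, h1⟩, ⟨r, hr, h2⟩, -, -⟩ := h
  have e1 := I.length_eq _ _ hab
  have e2 := I.length_eq _ _ hl
  have e3 := I.length_eq _ _ hr
  exact ⟨l, r, hl, hab, hr, by rw [← e1, ← e2]; exact h1, by rw [← e1, ← e3]; exact h2⟩

theorem Monocrimp.realizes {n : ℕ} {p : ℕ → ℝ} {a b : ℕ} {S T : PState}
    (h : Monocrimp a b S T) (I : Realizes n p S) : Realizes n p T := by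
  obtain ⟨l, r, c⟩ := h.canCrimp I
  obtain ⟨-, -, -, hT, hpos⟩ := h
  have lla := c.la.2.2.1
  have lab := c.ab.2.2.1
  have lbr := c.br.2.2.1
  have rn := I.le_last r c.br.2.1
  refine ⟨?_, ?_, ?_, ?_, ?_⟩
  · rw [hT, Finset.mem_sdiff]
    refine ⟨I.zero_mem, ?_⟩
    simp only [Finset.mem_insert, Finset.mem_singleton]
    omega
  · rw [hT, Finset.mem_sdiff]
    refine ⟨I.last_mem, ?_⟩
    simp only [Finset.mem_insert, Finset.mem_singleton]
    omega
  · rw [hT]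
    exact fun x hx => I.le_last x (Finset.mem_sdiff.1 hx).1
  · rw [hT]
    exact c.alternating I.alternating
  · intro x y hxy
    have e0 := I.length_eq _ _ c.ab
    have e1 := I.length_eq _ _ c.la
    have e2 := I.length_eq _ _ c.br
    rw [hT, adjacent_sdiff_pair c.la c.ab c.br] at hxy
    rw [hpos]
    rcases hxy with ⟨hxy, h1, h2, h3, h4, h5, h6⟩ | ⟨rfl, rfl⟩
    · have e := I.length_eq _ _ hxy
      have := hxy.2.2.1
      have hb := hxy.2.2.2 b c.ab.2.1
      by_cases hbx : b < x
      · simp only [hbx, show b < y by omega, if_true]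
        rw [← e]
        ring
      · simp only [hbx, show ¬ b < y by omega, if_false]
        rw [e]
    · simp only [lbr, show ¬ b < x by omega, if_true, if_false]
      rcases c.shape I.alternating with ⟨-, -, -, -, h1, h2, h3⟩ | ⟨-, -, -, -, h1, h2, h3⟩
      · rw [abs_of_neg (by linarith)] at e0
        rw [abs_of_nonneg (by linarith)] at e1 e2
        rw [abs_of_nonneg (by linarith)]
        linarith
      · rw [abs_of_pos (by linarith)] at e0
        rw [abs_of_nonpos (by linarith)] at e1 e2
        rw [abs_of_nonpos (by linarith)]
        linarith

theorem Monocrimp.card_alive {a b : ℕ} {S T : PState} (h : Monocrimp a b S T) : T.alive.card + 2 = S.alive.card := by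
  obtain ⟨hab, -, -, hT, -⟩ := h
  have hs : ({a, b} : Finset ℕ) ⊆ S.alive := by
    intro x hx
    simp only [Finset.mem_insert, Finset.mem_singleton] at hx
    rcases hx with rfl | rfl
    · exact hab.1
    · exact hab.2.1
  have := Finset.card_sdiff_add_card_eq_card hs
  rwa [← hT, Finset.card_pair hab.2.2.1.ne] at this

/-- Every forcing set has at least half of the `survivors + e` minus the two ends elements. -/
def ForcingBound (n : ℕ) (p : ℕ → ℝ) (μ : ℕ → MV) (e : ℕ) (S : PState) : Prop :=
  ∀ F, Forcing n S.alive p μ F → S.alive.card + e ≤ 2 * F.card + 2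

theorem Monocrimp.forcingBound {n : ℕ} {p : ℕ → ℝ} {μ : ℕ → MV} {e a b : ℕ} {S T : PState}
    (h : Monocrimp a b S T) (I : Realizes n p S) (hμ : μ a ≠ μ b) (Fμ : Foldable S.alive p μ)
    (L : ForcingBound n p μ e T) : ForcingBound n p μ e S := by
  intro F hF
  obtain ⟨l, r, c⟩ := h.canCrimp I
  obtain ⟨F', hF', hc⟩ := c.exists_forcing I.alternating I.le_last hμ Fμ hF
  rw [← h.2.2.2.1] at hF'
  have h1 := L F' hF'
  have h2 := h.card_alive
  omega

theorem Monocrimp.foldable {n : ℕ} {p : ℕ → ℝ} {μ : ℕ → MV} {a b : ℕ} {S T : PState}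
    (h : Monocrimp a b S T) (I : Realizes n p S) (hμ : μ a ≠ μ b) (Fμ : Foldable S.alive p μ) :
    Foldable T.alive p μ := by
  obtain ⟨l, r, c⟩ := h.canCrimp I
  rw [h.2.2.2.1]
  exact c.foldable I.alternating hμ Fμ

/-- What a sequence of monocrimps inside `α` does to the pattern. -/
theorem exists_balanced_of_steps {n : ℕ} {p : ℕ → ℝ} {μ : ℕ → MV} {α : Finset ℕ} {m : ℕ}
    {W : ℕ → PState} (hW : ∀ t, t < m → StepInMV μ α (W t) (W (t + 1)))
    (I : Realizes n p (W 0)) (Fμ : Foldable (W 0).alive p μ) :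
    Realizes n p (W m) ∧ Foldable (W m).alive p μ ∧ (W m).alive ⊆ (W 0).alive ∧
      (W 0).alive \ (W m).alive ⊆ α ∧
      (∃ k, ((W 0).alive \ (W m).alive).card = 2 * k ∧
        (((W 0).alive \ (W m).alive).filter (fun x => μ x = MV.M)).card = k ∧
        (((W 0).alive \ (W m).alive).filter (fun x => μ x = MV.V)).card = k) ∧
      ∀ e, ForcingBound n p μ e (W m) → ForcingBound n p μ e (W 0) := by
  induction m with
  | zero => exact ⟨I, Fμ, subset_rfl, by simp, ⟨0, by simp⟩, fun e h => h⟩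
  | succ m ih =>
    obtain ⟨I', F', hsub, hα, ⟨k, h1, h2, h3⟩, hL⟩ := ih fun t ht => hW t (by omega)
    obtain ⟨a, b, ha, hb, hμ, hab⟩ := hW m (by omega)
    have hT := hab.2.2.2.1
    have hne := hab.1.2.2.1.ne
    have haW : a ∉ (W 0).alive \ (W m).alive := fun h => (Finset.mem_sdiff.1 h).2 hab.1.1
    have hbW : b ∉ (W 0).alive \ (W m).alive := fun h => (Finset.mem_sdiff.1 h).2 hab.1.2.1
    have hdiff : (W 0).alive \ (W (m + 1)).alive =
        insert a (insert b ((W 0).alive \ (W m).alive)) := by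
      ext x
      rw [hT]
      simp only [Finset.mem_sdiff, Finset.mem_insert, Finset.mem_singleton]
      by_cases hxa : x = a
      · simp [hxa, hsub hab.1.1]
      · by_cases hxb : x = b
        · simp [hxb, hsub hab.1.2.1]
        · simp [hxa, hxb]
    have haW' : a ∉ insert b ((W 0).alive \ (W m).alive) := by
      rw [Finset.mem_insert]
      exact fun h => h.elim hne haW
    refine ⟨hab.realizes I', hab.foldable I' hμ F', ?_, ?_, ⟨k + 1, ?_, ?_, ?_⟩, ?_⟩
    · rw [hT]
      exact Finset.sdiff_subset.trans hsub
    · rw [hdiff]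
      exact Finset.insert_subset ha (Finset.insert_subset hb hα)
    · rw [hdiff, Finset.card_insert_of_notMem haW', Finset.card_insert_of_notMem hbW, h1]
      ring
    all_goals try exact fun e h => hL e (hab.forcingBound I' hμ F' h)
    all_goals
      rw [hdiff, Finset.filter_insert, Finset.filter_insert]
      have ha2 : ∀ P : ℕ → Prop, [DecidablePred P] →
          a ∉ ((W 0).alive \ (W m).alive).filter P := fun P _ h => haW (Finset.mem_filter.1 h).1
      have hb2 : ∀ P : ℕ → Prop, [DecidablePred P] →
          b ∉ ((W 0).alive \ (W m).alive).filter P := fun P _ h => hbW (Finset.mem_filter.1 h).1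
      cases e1 : μ a <;> cases e2 : μ b <;> simp_all

theorem CrimpOpMV.spec {n : ℕ} {p : ℕ → ℝ} {μ : ℕ → MV} {α : Finset ℕ} {S T : PState}
    (h : CrimpOpMV μ α S T) (I : Realizes n p S) (Fμ : Foldable S.alive p μ) :
    Realizes n p T ∧ Foldable T.alive p μ ∧ T.alive ⊆ S.alive ∧
      (∀ e, ForcingBound n p μ e T → ForcingBound n p μ e S) ∧
      ∀ F, Forcing n T.alive p μ F → ∃ F', Forcing n S.alive p μ F' ∧
        2 * F'.card + T.alive.card = 2 * F.card + S.alive.card := by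
  obtain ⟨⟨d, hd⟩, ⟨m, W, rfl, rfl, hW⟩, hone⟩ := h
  obtain ⟨I', F', hsub, hα, ⟨k, h1, h2, h3⟩, hL⟩ := exists_balanced_of_steps hW I Fμ
  refine ⟨I', F', hsub, hL, fun F hF => ?_⟩
  obtain ⟨l, r, q, R, hmem⟩ := hd.run I.alternating I.length_eq
  obtain ⟨F₁, hF₁, hc⟩ := R.exists_forcing I.alternating I.le_last hsub I'.alternating
    (fun x hx hx' => ((hmem x).1 (hα (Finset.mem_sdiff.2 ⟨hx, hx'⟩))).2)
    (fun x hx y hy h1 h2 h3 h4 => Finset.card_le_one.1 hone x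
      (Finset.mem_inter.2 ⟨hx, (hmem x).2 ⟨hsub hx, h1, h2⟩⟩) y
      (Finset.mem_inter.2 ⟨hy, (hmem y).2 ⟨hsub hy, h3, h4⟩⟩)) h1 (h2.trans h3.symm) hF
  refine ⟨F₁, hF₁, ?_⟩
  have := Finset.card_sdiff_add_card_eq_card hsub
  omega

/-- Once every labeling is flat-foldable, a forcing set consists of all remaining creases. -/
theorem Forcing.eq_of_forall_foldable {n : ℕ} {s : Finset ℕ} {p : ℕ → ℝ} {μ : ℕ → MV}
    {F : Finset ℕ} (hF : Forcing n s p μ F) (h : ∀ ν, Foldable s p ν) : F = s \ {0, n} := by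
  refine Finset.Subset.antisymm (fun x hx => ?_) (fun x hx => ?_)
  · have := hF.1 x hx
    simpa using this
  · by_contra hxF
    obtain ⟨τ, hτ⟩ : ∃ τ, τ ≠ μ x := by
      cases μ x
      · exact ⟨MV.V, by simp⟩
      · exact ⟨MV.M, by simp⟩
    simp only [Finset.mem_sdiff, Finset.mem_insert, Finset.mem_singleton, not_or] at hx
    have := hF.2 (Function.update μ x τ) (h _) (fun z hz => ?_) x hx.1 hx.2.1 hx.2.2
    · rw [Function.update_self] at this
      exact hτ this
    · rw [Function.update_of_ne]
      rintro rfl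
      exact hxF hz

/-- The forcing sets along an exhaustive sequence of crimps. -/
theorem exists_forcing_of_crimps {n : ℕ} {p : ℕ → ℝ} {μ : ℕ → MV} {m : ℕ} {α : ℕ → Finset ℕ}
    {S : ℕ → PState} (hn : 1 ≤ n) (hS : ∀ t, t < m → CrimpOpMV μ (α t) (S t) (S (t + 1)))
    (hx : Exhausted (S m)) (I : Realizes n p (S 0)) (Fμ : Foldable (S 0).alive p μ) :
    2 ≤ (S m).alive.card ∧ (S m).alive.card ≤ (S 0).alive.card ∧
    ForcingBound n p μ ((S m).alive.card - 2) (S 0) ∧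
      ∃ F, Forcing n (S 0).alive p μ F ∧
        2 * F.card + 2 = (S 0).alive.card + ((S m).alive.card - 2) := by
  induction m generalizing S α with
  | zero =>
    have hfold := hx.foldable I.alternating I.length_eq
    have hs : ({0, n} : Finset ℕ) ⊆ (S 0).alive := by
      intro x hx
      simp only [Finset.mem_insert, Finset.mem_singleton] at hx
      rcases hx with rfl | rfl
      · exact I.zero_mem
      · exact I.last_mem
    have hcard := Finset.card_sdiff_add_card_eq_card hs
    rw [Finset.card_pair (by omega)] at hcard
    refine ⟨by omega, le_rfl, fun F hF => ?_, (S 0).alive \ {0, n}, ⟨fun x hx => ?_, ?_⟩, ?_⟩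
    · rw [hF.eq_of_forall_foldable hfold]
      omega
    · simpa using hx
    · intro ν _ hag x hx h0 h1
      exact hag x (by simp [hx, h0, h1])
    · omega
  | succ m ih =>
    obtain ⟨I', F', hsub, hL, hU⟩ := (hS 0 (by omega)).spec I Fμ
    obtain ⟨h1, h2, h3, F, hF, h4⟩ := ih (α := fun t => α (t + 1)) (S := fun t => S (t + 1))
      (fun t ht => hS (t + 1) (by omega)) hx I' F'
    obtain ⟨F₁, hF₁, h5⟩ := hU F hF
    have h6 := Finset.card_le_card hsub
    simp only [zero_add] at *
    exact ⟨h1, h2.trans h6, hL _ h3, F₁, hF₁, by omega⟩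

theorem foldCrease_succ (c : ℕ → ℝ) (j : ℕ) : foldCrease c (j + 1) = foldPos c j (c (j + 1)) := by
  unfold foldCrease foldPos
  rw [show foldOffset c (j + 1) = foldOffset c j + 2 * (-1) ^ j * c (j + 1) from rfl]
  ring

theorem foldCrease_succ_sub (c : ℕ → ℝ) (j : ℕ) :
    foldCrease c (j + 1) - foldCrease c j = (-1) ^ j * (c (j + 1) - c j) := by
  rw [foldCrease_succ]
  unfold foldCrease foldPos
  ring

theorem adjacent_range {n a b : ℕ} : Adjacent (Finset.range (n + 1)) a b ↔ b = a + 1 ∧ a < n := by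
  unfold Adjacent
  simp only [Finset.mem_range]
  constructor
  · rintro ⟨h1, h2, h3, h4⟩
    have := h4 (a + 1)
    omega
  · rintro ⟨rfl, h⟩
    exact ⟨by omega, by omega, by omega, fun x _ _ => by omega⟩

theorem realizes_initState {n : ℕ} {c : ℕ → ℝ} (hC : IsCreasePattern n c) :
    Realizes n (foldCrease c) (initState n c) := by
  refine ⟨by simp [initState], by simp [initState], ?_, ?_, ?_⟩
  · intro x hx
    simp only [initState, Finset.mem_range] at hx
    omega
  · intro a b hab
    obtain ⟨rfl, ha⟩ := adjacent_range.1 hab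
    have h := hC.2 a (a + 1) (by omega) (by omega)
    have e := foldCrease_succ_sub c a
    rcases Nat.even_or_odd a with h1 | h1
    · rw [h1.neg_one_pow] at e
      exact Or.inl ⟨h1, h1.add_one, by linarith⟩
    · rw [h1.neg_one_pow] at e
      exact Or.inr ⟨h1, h1.add_one, by linarith⟩
  · intro a b hab
    obtain ⟨rfl, ha⟩ := adjacent_range.1 hab
    have h := hC.2 a (a + 1) (by omega) (by omega)
    rw [foldCrease_succ_sub, abs_mul, abs_neg_one_pow, one_mul, abs_of_pos (by linarith)]
    rfl

theorem inside_iff_min_max {x y z : ℝ} : Inside x y z ↔ z ∈ Set.Ioo (min x y) (max x y) := by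
  unfold Inside
  simp only [Set.mem_Ioo, min_lt_iff, lt_max_iff]
  rcases lt_trichotomy x y with h | h | h
  · constructor
    · rintro (h1 | h1)
      · exact ⟨Or.inl h1.1, Or.inr h1.2⟩
      · linarith
    · rintro ⟨h1 | h1, h2 | h2⟩
      · linarith
      · exact Or.inl ⟨h1, h2⟩
      · linarith
      · linarith
  · subst h
    simp only [or_self]
  · constructor
    · rintro (h1 | h1)
      · linarith
      · exact ⟨Or.inr h1.1, Or.inl h1.2⟩
    · rintro ⟨h1 | h1, h2 | h2⟩
      · linarith
      · linarith
      · exact Or.inr ⟨h1, h2⟩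
      · linarith

theorem up_succ_iff {t : MV} {a : ℕ} :
    Up t (a + 1) ↔ (t = MV.V ∧ Even a) ∨ (t = MV.M ∧ Odd a) := by
  unfold Up
  rw [Nat.odd_add_one, Nat.even_add_one, Nat.not_odd_iff_even, Nat.not_even_iff_odd]

theorem foldable_of_isFlatFoldable {n : ℕ} {c : ℕ → ℝ} (hC : IsCreasePattern n c) {ν : ℕ → MV}
    (hF : IsFlatFoldable n c ν) : Foldable (Finset.range (n + 1)) (foldCrease c) ν := by
  obtain ⟨lt, irr, trans, tri, bd, hup, htort, htaco⟩ := hF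
  classical
  obtain ⟨h, hh⟩ : ∃ h : ℕ → ℤ, ∀ a b, a < n → b < n → (lt a b ↔ h a < h b) := by
    have mono : ∀ a b, lt a b → ((Finset.range n).filter (fun x => lt x a)).card <
        ((Finset.range n).filter (fun x => lt x b)).card := by
      intro a b hab
      refine Finset.card_lt_card ⟨fun x hx => ?_, fun hs => ?_⟩
      · obtain ⟨h1, h2⟩ := Finset.mem_filter.1 hx
        exact Finset.mem_filter.2 ⟨h1, trans _ _ _ h2 hab⟩
      · have ha := (bd a b hab).1
        have := hs (Finset.mem_filter.2 ⟨Finset.mem_range.2 ha, hab⟩)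
        exact irr a ha (Finset.mem_filter.1 this).2
    refine ⟨fun a => ((Finset.range n).filter (fun x => lt x a)).card, fun a b ha hb =>
      ⟨fun hab => Int.ofNat_lt.2 (mono a b hab), fun hab => ?_⟩⟩
    have hab' : ((Finset.range n).filter (fun x => lt x a)).card <
        ((Finset.range n).filter (fun x => lt x b)).card := Int.ofNat_lt.1 hab
    by_contra hc
    by_cases e : a = b
    · subst e
      exact lt_irrefl _ hab'
    · rcases tri a b ha hb e with h1 | h1
      · exact hc h1
      · exact lt_asymm hab' (mono b a h1)
  have between : ∀ a b x, a < n → b < n → x < n →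
      (Inside (h a) (h b) (h x) ↔ Between lt a b x) := by
    intro a b x ha hb hx
    unfold Inside Between
    rw [hh a x ha hx, hh x b hx hb, hh b x hb hx, hh x a hx ha]
  refine ⟨h, ⟨?_, (realizes_initState hC).alternating.turn, ?_, ?_⟩, ?_⟩
  · intro a b a' b' hab hab' e
    obtain ⟨rfl, ha⟩ := adjacent_range.1 hab
    obtain ⟨rfl, ha'⟩ := adjacent_range.1 hab'
    by_contra hne
    rcases tri a a' ha ha' hne with h1 | h1
    · have := (hh a a' ha ha').1 h1
      omega
    · have := (hh a' a ha' ha).1 h1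
      omega
  · intro a b x u v hab hbx huv hin
    obtain ⟨rfl, ha⟩ := adjacent_range.1 hab
    obtain ⟨rfl, hb⟩ := adjacent_range.1 hbx
    obtain ⟨rfl, hu⟩ := adjacent_range.1 huv
    rw [between a (a + 1) u ha hb hu]
    rw [inside_iff_min_max, foldCrease_succ c u] at hin
    exact htort (a + 1) (by omega) (by omega) u hu hin
  · intro a b x a' b' x' hab hbx hab' hbx' e
    obtain ⟨rfl, ha⟩ := adjacent_range.1 hab
    obtain ⟨rfl, hb⟩ := adjacent_range.1 hbx
    obtain ⟨rfl, ha'⟩ := adjacent_range.1 hab'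
    obtain ⟨rfl, hb'⟩ := adjacent_range.1 hbx'
    by_cases haa : a = a'
    · subst haa
      unfold Inside
      omega
    · rw [between _ _ _ ha hb ha', between _ _ _ ha hb hb']
      exact htaco (a + 1) (a' + 1) (by omega) (by omega) (by omega) (by omega) (by omega) e
  · intro a b x hab hbx
    obtain ⟨rfl, ha⟩ := adjacent_range.1 hab
    obtain ⟨rfl, hb⟩ := adjacent_range.1 hbx
    rw [← hh a (a + 1) ha hb, up_succ_iff]
    exact hup (a + 1) (by omega) (by omega)

theorem isFlatFoldable_of_foldable {n : ℕ} {c : ℕ → ℝ} {ν : ℕ → MV}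
    (hF : Foldable (Finset.range (n + 1)) (foldCrease c) ν) : IsFlatFoldable n c ν := by
  obtain ⟨h, hs, hup⟩ := hF
  have adj : ∀ a, a < n → Adjacent (Finset.range (n + 1)) a (a + 1) := fun a ha =>
    adjacent_range.2 ⟨rfl, ha⟩
  have between : ∀ a b x, a < n → b < n → x < n →
      (Inside (h a) (h b) (h x) ↔
        Between (fun a b => a < n ∧ b < n ∧ h a < h b) a b x) := by
    intro a b x ha hb hx
    simp only [Inside, Between, ha, hb, hx, true_and]
  refine ⟨fun a b => a < n ∧ b < n ∧ h a < h b, fun j _ h => lt_irrefl _ h.2.2,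
    fun a b e h1 h2 => ⟨h1.1, h2.2.1, h1.2.2.trans h2.2.2⟩, fun a b ha hb hab => ?_,
    fun a b h => ⟨h.1, h.2.1⟩, ?_, ?_, ?_⟩
  · rcases lt_trichotomy (h a) (h b) with h1 | h1 | h1
    · exact Or.inl ⟨ha, hb, h1⟩
    · exact absurd (hs.inj a _ b _ (adj a ha) (adj b hb) h1) hab
    · exact Or.inr ⟨hb, ha, h1⟩
  · intro i h1 h2
    obtain ⟨a, rfl⟩ : ∃ a, i = a + 1 := ⟨i - 1, by omega⟩
    rw [Nat.add_sub_cancel, ← up_succ_iff,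
      ← hup a (a + 1) (a + 2) (adj a (by omega)) (adj (a + 1) (by omega))]
    exact ⟨fun h => h.2.2, fun h => ⟨by omega, by omega, h⟩⟩
  · intro i h1 h2 j hj hin
    obtain ⟨a, rfl⟩ : ∃ a, i = a + 1 := ⟨i - 1, by omega⟩
    rw [Nat.add_sub_cancel, ← between a (a + 1) j (by omega) (by omega) hj]
    rw [← foldCrease_succ, ← inside_iff_min_max] at hin
    exact hs.tort a (a + 1) (a + 2) j (j + 1) (adj a (by omega)) (adj (a + 1) (by omega))
      (adj j hj) hin
  · intro i j h1 h2 h3 h4 _ e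
    obtain ⟨a, rfl⟩ : ∃ a, i = a + 1 := ⟨i - 1, by omega⟩
    obtain ⟨b, rfl⟩ : ∃ b, j = b + 1 := ⟨j - 1, by omega⟩
    rw [Nat.add_sub_cancel, Nat.add_sub_cancel,
      ← between a (a + 1) b (by omega) (by omega) (by omega),
      ← between a (a + 1) (b + 1) (by omega) (by omega) (by omega)]
    exact hs.taco a (a + 1) (a + 2) b (b + 1) (b + 2) (adj a (by omega)) (adj (a + 1) (by omega))
      (adj b (by omega)) (adj (b + 1) (by omega)) e

theorem isForcingSet_iff_forcing {n : ℕ} {c : ℕ → ℝ} (hC : IsCreasePattern n c) {μ : ℕ → MV}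
    {F : Finset ℕ} : IsForcingSet n c μ (↑F : Set ℕ) ↔
      Forcing n (Finset.range (n + 1)) (foldCrease c) μ F := by
  have hn := hC.1
  constructor
  · rintro ⟨h1, h2⟩
    refine ⟨fun x hx => ?_, fun ν hν hag x hx h0 hxn => ?_⟩
    · have := h1 hx
      simp only [Set.mem_Icc] at this
      simp only [Finset.mem_range]
      omega
    · have := Finset.mem_range.1 hx
      exact h2 ν (isFlatFoldable_of_foldable hν) hag x (by omega) (by omega)
  · rintro ⟨h1, h2⟩
    refine ⟨fun x hx => ?_, fun ν hν hag x h0 hxn => ?_⟩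
    · have := h1 x hx
      simp only [Finset.mem_range] at this
      simp only [Set.mem_Icc]
      omega
    · exact h2 ν (foldable_of_isFlatFoldable hC hν) hag x (Finset.mem_range.2 (by omega))
        (by omega) (by omega)

/-- Minimum forcing set size.  Let `(C, μ)` be a flat-foldable MV pattern with creases
`c 1, …, c (n-1)`, and perform any exhaustive sequence of crimp operations on `C` in
which every monocrimp is at an adjacent pair of remaining creases of opposite μ-value.
Let `e` be the number of creases remaining in the final pattern and `m = ((n-1) - e)/2`
the total number of monocrimps performed.  Then `(C, μ)` has a forcing set of cardinality
`m + e`, and every forcing set has cardinality at least `m + e`: the minimum cardinality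
of a forcing set equals `m + e = ((n-1) + e)/2`. -/
theorem min_forcing_set_size (n : ℕ) (c : ℕ → ℝ) (μ : ℕ → MV)
    (hC : IsCreasePattern n c) (hF : IsFlatFoldable n c μ)
    (m : ℕ) (α : ℕ → Finset ℕ) (S : ℕ → PState)
    (h : CrimpSeqMV μ n c m α S) (hx : Exhausted (S m)) :
    (∃ F : Finset ℕ, IsForcingSet n c μ (↑F : Set ℕ) ∧
        F.card = (n - 1 - ((S m).alive.card - 2)) / 2 + ((S m).alive.card - 2)) ∧
    (∀ F : Finset ℕ, IsForcingSet n c μ (↑F : Set ℕ) →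
        (n - 1 - ((S m).alive.card - 2)) / 2 + ((S m).alive.card - 2) ≤ F.card) := by
  have hn := hC.1
  have e0 : (S 0).alive = Finset.range (n + 1) := by rw [h.1, initState]
  obtain ⟨h1, h2, h3, F, hF', h4⟩ := exists_forcing_of_crimps hn h.2 hx
    (h.1 ▸ realizes_initState hC) (e0 ▸ foldable_of_isFlatFoldable hC hF)
  rw [ForcingBound, e0] at h3
  rw [e0] at h2 hF' h4
  rw [Finset.card_range] at h2 h3 h4
  refine ⟨⟨F, (isForcingSet_iff_forcing hC).2 hF', by omega⟩, fun F' hF' => ?_⟩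
  have := h3 F' ((isForcingSet_iff_forcing hC).1 hF')
  omega
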